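/- arXiv:1207.0062 — 8 statements merged into one kernel-verified Lean document; each statement's English description precedes it below -/
import Mathlib

section
/- Let ε ∈ {1, −1}. If ρ(R, −r; R', r') = ε · ρ(R, r; R', r') for all R, r, R', r' ∈ ℝ^d (i.e. ρ is symmetric, resp. antisymmetric, under exchange of the two particles in its first set of variables), then for all R, P, v, p ∈ ℝ^d one has ω̃_{R,P}(v, p) = ε · ω̃_{R,P}(p, v). -/
open MeasureTheory
open scoped RealInnerProductSpace

/-- Fubini's theorem for a product of three spaces. -/
theorem integral_prod_prod {α β γ G : Type*} [MeasurableSpace α]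
    [MeasurableSpace β] [MeasurableSpace γ] [NormedAddCommGroup G] [NormedSpace ℝ G]
    {μ : Measure α} {ν : Measure β} {τ : Measure γ} [SFinite μ] [SFinite ν] [SFinite τ]
    {F : α × β × γ → G} (hF : Integrable F (μ.prod (ν.prod τ))) :
    ∫ x, F x ∂μ.prod (ν.prod τ) = ∫ a, ∫ b, ∫ c, F (a, b, c) ∂τ ∂ν ∂μ := by
  rw [integral_prod _ hF]
  refine integral_congr_ae ?_
  filter_upwards [hF.prod_right_ae] with a ha
  exact integral_prod _ ha

/-- Reversing the order of integration in a triple iterated integral. -/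
theorem integral_integral_integral_reverse {α β γ G : Type*} [MeasurableSpace α]
    [MeasurableSpace β] [MeasurableSpace γ] [NormedAddCommGroup G] [NormedSpace ℝ G]
    {μ : Measure α} {ν : Measure β} {τ : Measure γ} [SFinite μ] [SFinite ν] [SFinite τ]
    {F : α × β × γ → G} (hF : Integrable F (μ.prod (ν.prod τ))) :
    ∫ a, ∫ b, ∫ c, F (a, b, c) ∂τ ∂ν ∂μ = ∫ c, ∫ b, ∫ a, F (a, b, c) ∂μ ∂ν ∂τ := by
  let e : γ × β × α ≃ᵐ α × β × γ := MeasurableEquiv.prodComm.trans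
    ((MeasurableEquiv.prodCongr MeasurableEquiv.prodComm (MeasurableEquiv.refl γ)).trans
      MeasurableEquiv.prodAssoc)
  have he : MeasurePreserving e (τ.prod (ν.prod μ)) (μ.prod (ν.prod τ)) :=
    (measurePreserving_prodAssoc μ ν τ).comp
      ((Measure.measurePreserving_swap.prod (MeasurePreserving.id τ)).comp
        Measure.measurePreserving_swap)
  rw [← integral_prod_prod hF, ← he.integral_comp' F]
  exact integral_prod_prod ((he.integrable_comp_emb e.measurableEmbedding).2 hF)

/-- A Schwartz function of the arguments of a Wigner transform, evaluated at
`((R - Z, r - z), (R + Z, r + z))`, is integrable in `(r, Z, z)`. -/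
theorem SchwartzMap.integrable_wigner {E : Type*} [NormedAddCommGroup E] [NormedSpace ℝ E]
    [FiniteDimensional ℝ E] [MeasureSpace E] [BorelSpace E]
    [(volume : Measure E).IsAddHaarMeasure]
    (ρ : SchwartzMap ((E × E) × (E × E)) ℂ) (R : E) :
    Integrable fun x : E × E × E ↦
      ρ ((R - x.2.1, x.1 - x.2.2), (R + x.2.1, x.1 + x.2.2)) := by
  let g : E × E × E → (E × E) × (E × E) := fun x ↦
    ((R - x.2.1, x.1 - x.2.2), (R + x.2.1, x.1 + x.2.2))
  have hg : g.HasTemperateGrowth := by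
    let r := ContinuousLinearMap.fst ℝ E (E × E)
    let Z := (ContinuousLinearMap.fst ℝ E E).comp (ContinuousLinearMap.snd ℝ E (E × E))
    let z := (ContinuousLinearMap.snd ℝ E E).comp (ContinuousLinearMap.snd ℝ E (E × E))
    let L := ((-Z).prod (r - z)).prod (Z.prod (r + z))
    have hgL : g = fun x ↦ ((R, 0), (R, 0)) + L x := by
      ext x <;> simp [g, L, r, Z, z, sub_eq_add_neg]
    rw [hgL]
    fun_prop
  have hg' : AntilipschitzWith 1 g := by
    refine AntilipschitzWith.of_le_mul_dist fun x y ↦ ?_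
    have half (a b : E) : ‖a‖ ≤ max ‖b - a‖ ‖b + a‖ := by
      have h : (2 : ℝ) • a = (b + a) - (b - a) := by rw [two_smul]; abel
      have h' := norm_sub_le (b + a) (b - a)
      rw [← h, norm_smul, Real.norm_ofNat] at h'
      rw [le_max_iff]
      by_contra! hc
      linarith
    have h1 := half (x.2.1 - y.2.1) 0
    have h2 := half (x.2.2 - y.2.2) (x.1 - y.1)
    have h3 := half (x.1 - y.1) (x.2.2 - y.2.2)
    simp only [g, dist_eq_norm, Prod.norm_def, Prod.fst_sub, Prod.snd_sub, NNReal.coe_one, one_mul]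
    rw [show R - x.2.1 - (R - y.2.1) = 0 - (x.2.1 - y.2.1) by abel,
      show R + x.2.1 - (R + y.2.1) = 0 + (x.2.1 - y.2.1) by abel,
      show x.1 - x.2.2 - (y.1 - y.2.2) = (x.1 - y.1) - (x.2.2 - y.2.2) by abel,
      show x.1 + x.2.2 - (y.1 + y.2.2) = (x.1 - y.1) + (x.2.2 - y.2.2) by abel]
    rw [norm_sub_rev (x.2.2 - y.2.2), add_comm] at h3
    exact max_le (h3.trans (max_le_max (le_max_right _ _) (le_max_right _ _)))
      (max_le (h1.trans (max_le_max (le_max_left _ _) (le_max_left _ _)))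
        (h2.trans (max_le_max (le_max_right _ _) (le_max_right _ _))))
  have : (volume : Measure (E × E)).IsAddHaarMeasure :=
    Measure.prod.instIsAddHaarMeasure volume volume
  have : (volume : Measure (E × E × E)).IsAddHaarMeasure :=
    Measure.prod.instIsAddHaarMeasure volume volume
  exact (SchwartzMap.compCLMOfAntilipschitz ℝ hg hg' ρ).integrable

/-- If the density matrix ρ is symmetric (ε = 1) resp. antisymmetric (ε = -1) under
exchange of the two particles in its first (unprimed) set of variables, i.e.
ρ(R, -r; R', r') = ε·ρ(R, r; R', r') in extracule/intracule coordinates, then the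
intracule partial Fourier transform of its Wigner function satisfies
ω̃_{R,P}(v, p) = ε·ω̃_{R,P}(p, v). -/
theorem stmt_0 (d : ℕ) (hd : 1 ≤ d) (ε : ℂ) (hε : ε = 1 ∨ ε = -1)
(ρ : SchwartzMap ((EuclideanSpace ℝ (Fin d) × EuclideanSpace ℝ (Fin d)) ×
      (EuclideanSpace ℝ (Fin d) × EuclideanSpace ℝ (Fin d))) ℂ)
    (W : EuclideanSpace ℝ (Fin d) → EuclideanSpace ℝ (Fin d) →
      EuclideanSpace ℝ (Fin d) → EuclideanSpace ℝ (Fin d) → ℂ)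
    (hW : ∀ R r P p, W R r P p =
      ((Real.pi : ℂ) ^ (2 * d))⁻¹ *
        ∫ Z : EuclideanSpace ℝ (Fin d), ∫ z : EuclideanSpace ℝ (Fin d),
          ρ ((R - Z, r - z), (R + Z, r + z)) *
            Complex.exp (2 * Complex.I * ((⟪P, Z⟫ + ⟪p, z⟫ : ℝ) : ℂ)))
    (ω : EuclideanSpace ℝ (Fin d) → EuclideanSpace ℝ (Fin d) →
      EuclideanSpace ℝ (Fin d) → EuclideanSpace ℝ (Fin d) → ℂ)
    (hω : ∀ R P v p, ω R P v p =
      ∫ r : EuclideanSpace ℝ (Fin d),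
        W R r P p * Complex.exp (2 * Complex.I * ((⟪v, r⟫ : ℝ) : ℂ)))
    (hsym : ∀ R r R' r', ρ ((R, -r), (R', r')) = ε * ρ ((R, r), (R', r'))) :
    ∀ R P v p, ω R P v p = ε * ω R P p v := by
  intro R P v p
  let K (p v : EuclideanSpace ℝ (Fin d)) (x : EuclideanSpace ℝ (Fin d) ×
      EuclideanSpace ℝ (Fin d) × EuclideanSpace ℝ (Fin d)) : ℂ :=
    ρ ((R - x.2.1, x.1 - x.2.2), (R + x.2.1, x.1 + x.2.2)) *
      Complex.exp (((2 * (⟪P, x.2.1⟫ + ⟪p, x.2.2⟫ + ⟪v, x.1⟫) : ℝ) : ℂ) * Complex.I)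
  have hK : Integrable (K p v) := by
    refine (ρ.integrable_wigner R).mul_bdd (c := 1) ?_ (ae_of_all _ fun x ↦ ?_)
    · exact Continuous.aestronglyMeasurable (by fun_prop)
    · rw [Complex.norm_exp_ofReal_mul_I]
  have hωK (v p) : ω R P v p = ((Real.pi : ℂ) ^ (2 * d))⁻¹ *
      ∫ r, ∫ Z, ∫ z, K p v (r, Z, z) := by
    simp_rw [hω, hW, mul_assoc, integral_const_mul, ← integral_mul_const]
    congr! 7 with r Z z
    simp only [K, mul_assoc, ← Complex.exp_add]
    congr 2
    push_cast
    ring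
  have hswap (r Z z) : K p v (r, Z, z) = ε * K v p (z, Z, r) := by
    simp only [K]
    rw [← mul_assoc, ← hsym, neg_sub, add_comm r z, add_right_comm]
  rw [hωK, hωK, integral_integral_integral_reverse hK]
  simp_rw [hswap, integral_const_mul]
  ring
end

section
/- Let ε ∈ {1, −1}. If ρ(R, r; R', −r') = ε · ρ(R, r; R', r') for all R, r, R', r' ∈ ℝ^d (i.e. ρ is symmetric, resp. antisymmetric, under exchange of the two particles in its second set of variables), then for all R, P, v, p ∈ ℝ^d one has ω̃_{R,P}(v, p) = ε · ω̃_{R,P}(−p, −v). -/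
open MeasureTheory
open scoped RealInnerProductSpace

section PhaseSpace

variable {E : Type*} [NormedAddCommGroup E] [InnerProductSpace ℝ E] [FiniteDimensional ℝ E]
  [MeasurableSpace E] [BorelSpace E]

/-- Restricting a Schwartz function to the affine subspace that enters the Wigner function at a fixed
extracule position `R` gives an integrable function of `(r, Z, z)`. -/
theorem SchwartzMap.integrable_comp_wigner_coordinates
    (ρ : SchwartzMap ((E × E) × (E × E)) ℂ) (R : E) :
    Integrable fun x : E × E × E =>
      ρ ((R - x.2.1, x.1 - x.2.2), (R + x.2.1, x.1 + x.2.2)) := by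
  let g : E × E × E → (E × E) × (E × E) := fun x =>
    ((R - x.2.1, x.1 - x.2.2), (R + x.2.1, x.1 + x.2.2))
  have hg : g.HasTemperateGrowth := by
    let L : (E × E × E) →L[ℝ] (E × E) × (E × E) :=
      ((-(.fst ℝ E E ∘L .snd ℝ E (E × E))).prod
        (.fst ℝ E (E × E) - .snd ℝ E E ∘L .snd ℝ E (E × E))).prod
      ((.fst ℝ E E ∘L .snd ℝ E (E × E)).prod
        (.fst ℝ E (E × E) + .snd ℝ E E ∘L .snd ℝ E (E × E)))
    have hgL : g = (fun _ => ((R, 0), (R, 0))) + ⇑L := by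
      ext x : 1
      simp [g, L, sub_eq_add_neg]
    rw [hgL]
    exact (Function.HasTemperateGrowth.const _).add L.hasTemperateGrowth
  have hanti : AntilipschitzWith 1 g := by
    refine AntilipschitzWith.of_le_mul_dist fun x y => ?_
    have half_sub_le (a b : E) : ‖a‖ ≤ max ‖b - a‖ ‖b + a‖ := by
      have h : (2 : ℝ) • a = (b + a) - (b - a) := by rw [two_smul]; abel
      have h' := norm_sub_le (b + a) (b - a)
      rw [← h, norm_smul, Real.norm_ofNat] at h'
      linarith [le_max_left ‖b - a‖ ‖b + a‖, le_max_right ‖b - a‖ ‖b + a‖]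
    have h₁ := half_sub_le (x.2.1 - y.2.1) 0
    have h₂ := half_sub_le (x.2.2 - y.2.2) (x.1 - y.1)
    have h₃ := half_sub_le (x.1 - y.1) (x.2.2 - y.2.2)
    have e₁ : (R - x.2.1) - (R - y.2.1) = 0 - (x.2.1 - y.2.1) := by abel
    have e₂ : (R + x.2.1) - (R + y.2.1) = 0 + (x.2.1 - y.2.1) := by abel
    have e₃ : (x.1 - x.2.2) - (y.1 - y.2.2) = (x.1 - y.1) - (x.2.2 - y.2.2) := by abel
    have e₄ : (x.1 + x.2.2) - (y.1 + y.2.2) = (x.1 - y.1) + (x.2.2 - y.2.2) := by abel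
    rw [norm_sub_rev (x.2.2 - y.2.2), add_comm (x.2.2 - y.2.2)] at h₃
    simp only [g, dist_eq_norm, Prod.norm_def, Prod.fst_sub, Prod.snd_sub, e₁, e₂, e₃, e₄, NNReal.coe_one, one_mul]
    have hle {a b c d : ℝ} : max b d ≤ max (max a b) (max c d) :=
      max_le_max (le_max_right _ _) (le_max_right _ _)
    exact max_le (h₃.trans hle)
      (max_le (h₁.trans (max_le_max (le_max_left _ _) (le_max_left _ _))) (h₂.trans hle))
  have : (volume : Measure (E × E)).IsAddHaarMeasure :=
    Measure.prod.instIsAddHaarMeasure volume volume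
  have : (volume : Measure (E × E × E)).IsAddHaarMeasure :=
    Measure.prod.instIsAddHaarMeasure volume volume
  exact (SchwartzMap.compCLMOfAntilipschitz ℝ hg hanti ρ).integrable

/-- Multiplication by the phase `exp (2 i θ)` of a continuous real function `θ` preserves
integrability. -/
theorem MeasureTheory.Integrable.mul_exp_two_I {X : Type*} [TopologicalSpace X]
    [SecondCountableTopology X] [MeasurableSpace X] [OpensMeasurableSpace X] {μ : Measure X}
    {f : X → ℂ} (hf : Integrable f μ) {θ : X → ℝ} (hθ : Continuous θ) :
    Integrable (fun x => f x * Complex.exp (2 * Complex.I * (θ x : ℂ))) μ := by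
  refine hf.mul_bdd (c := 1) (by fun_prop) (.of_forall fun x => ?_)
  simp [Complex.norm_exp]

/-- Fubini's theorem for a triple product. -/
theorem MeasureTheory.integral_prod_prod {X Y Z F : Type*} [MeasureSpace X] [MeasureSpace Y]
    [MeasureSpace Z] [SFinite (volume : Measure X)] [SFinite (volume : Measure Y)]
    [SFinite (volume : Measure Z)] [NormedAddCommGroup F] [NormedSpace ℝ F]
    {G : X × Y × Z → F} (hG : Integrable G) :
    ∫ x, ∫ y, ∫ z, G (x, y, z) = ∫ w, G w := by
  rw [Measure.volume_eq_prod] at hG ⊢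
  rw [integral_prod _ hG]
  refine integral_congr_ae ?_
  filter_upwards [hG.prod_right_ae] with x hx
  rw [Measure.volume_eq_prod] at hx ⊢
  rw [integral_prod _ hx]

/-- The map `(r, Z, z) ↦ (-z, Z, -r)` preserves Lebesgue measure. -/
theorem MeasureTheory.measurePreserving_neg_swap_outer :
    MeasurePreserving (fun x : E × E × E => (-x.2.2, x.2.1, -x.1)) := by
  have hneg : MeasurePreserving (fun x : E => -x) := Measure.measurePreserving_neg volume
  have hid : MeasurePreserving (id : E → E) := MeasurePreserving.id volume
  have hswap : MeasurePreserving (Prod.swap : E × E → E × E) := Measure.measurePreserving_swap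
  have hcycle : MeasurePreserving (Prod.swap : E × E × E → (E × E) × E) :=
    Measure.measurePreserving_swap
  have hassoc : MeasurePreserving (MeasurableEquiv.prodAssoc : (E × E) × E ≃ᵐ E × E × E) :=
    measurePreserving_prodAssoc volume volume volume
  exact (hneg.prod (hid.prod hneg)).comp (hassoc.comp ((hswap.prod hid).comp hcycle))

/-- The outer variables of a triple integral may be interchanged, with a change of both signs. -/
theorem MeasureTheory.integral_neg_swap_outer {F : Type*} [NormedAddCommGroup F] [NormedSpace ℝ F]
    {G : E × E × E → F} (hG : Integrable G) :
    ∫ r, ∫ Z, ∫ z, G (r, Z, z) = ∫ r, ∫ Z, ∫ z, G (-z, Z, -r) := by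
  have hmp := measurePreserving_neg_swap_outer (E := E)
  rw [integral_prod_prod hG, integral_prod_prod (G := fun x : E × E × E => G (-x.2.2, x.2.1, -x.1))
    (hmp.integrable_comp_of_integrable hG)]
  conv_lhs => rw [← hmp.map_eq]
  refine integral_map hmp.aemeasurable ?_
  rw [hmp.map_eq]
  exact hG.aestronglyMeasurable

end PhaseSpace

open MeasureTheory
open scoped RealInnerProductSpace
/-- If the density matrix ρ is symmetric (ε = 1) resp. antisymmetric (ε = -1) under
exchange of the two particles in its second (primed) set of variables, i.e.
ρ(R, r; R', -r') = ε·ρ(R, r; R', r') in extracule/intracule coordinates, then the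
intracule partial Fourier transform of its Wigner function satisfies
ω̃_{R,P}(v, p) = ε·ω̃_{R,P}(-p, -v). -/
theorem stmt_1 (d : ℕ) (hd : 1 ≤ d) (ε : ℂ) (hε : ε = 1 ∨ ε = -1)
(ρ : SchwartzMap ((EuclideanSpace ℝ (Fin d) × EuclideanSpace ℝ (Fin d)) ×
      (EuclideanSpace ℝ (Fin d) × EuclideanSpace ℝ (Fin d))) ℂ)
    (W : EuclideanSpace ℝ (Fin d) → EuclideanSpace ℝ (Fin d) →
      EuclideanSpace ℝ (Fin d) → EuclideanSpace ℝ (Fin d) → ℂ)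
    (hW : ∀ R r P p, W R r P p =
      ((Real.pi : ℂ) ^ (2 * d))⁻¹ *
        ∫ Z : EuclideanSpace ℝ (Fin d), ∫ z : EuclideanSpace ℝ (Fin d),
          ρ ((R - Z, r - z), (R + Z, r + z)) *
            Complex.exp (2 * Complex.I * ((⟪P, Z⟫ + ⟪p, z⟫ : ℝ) : ℂ)))
    (ω : EuclideanSpace ℝ (Fin d) → EuclideanSpace ℝ (Fin d) →
      EuclideanSpace ℝ (Fin d) → EuclideanSpace ℝ (Fin d) → ℂ)
    (hω : ∀ R P v p, ω R P v p =
      ∫ r : EuclideanSpace ℝ (Fin d),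
        W R r P p * Complex.exp (2 * Complex.I * ((⟪v, r⟫ : ℝ) : ℂ)))
    (hsym : ∀ R r R' r', ρ ((R, r), (R', -r')) = ε * ρ ((R, r), (R', r'))) :
    ∀ R P v p, ω R P v p = ε * ω R P (-p) (-v) := by
  intro R P v p
  have hωeq (v p : EuclideanSpace ℝ (Fin d)) : ω R P v p = ((Real.pi : ℂ) ^ (2 * d))⁻¹ *
      ∫ r, ∫ Z, ∫ z, ρ ((R - Z, r - z), (R + Z, r + z)) *
        Complex.exp (2 * Complex.I * ((⟪P, Z⟫ + ⟪p, z⟫ + ⟪v, r⟫ : ℝ) : ℂ)) := by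
    simp only [hω, hW, mul_assoc (((Real.pi : ℂ) ^ (2 * d))⁻¹), integral_const_mul,
      ← integral_mul_const]
    simp only [Complex.ofReal_add, mul_add, Complex.exp_add, mul_assoc]
  rw [hωeq, hωeq, mul_left_comm]
  congr 1
  have hG := (ρ.integrable_comp_wigner_coordinates R).mul_exp_two_I
    (θ := fun x => ⟪P, x.2.1⟫ + ⟪p, x.2.2⟫ + ⟪v, x.1⟫) (by fun_prop)
  refine (integral_neg_swap_outer hG).trans ?_
  have hpt (r Z z : EuclideanSpace ℝ (Fin d)) :
      ρ ((R - Z, -z - -r), (R + Z, -z + -r)) *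
          Complex.exp (2 * Complex.I * ((⟪P, Z⟫ + ⟪p, -r⟫ + ⟪v, -z⟫ : ℝ) : ℂ)) =
        ε * (ρ ((R - Z, r - z), (R + Z, r + z)) *
          Complex.exp (2 * Complex.I * ((⟪P, Z⟫ + ⟪-v, z⟫ + ⟪-p, r⟫ : ℝ) : ℂ))) := by
    have hr : -z - -r = r - z := by abel
    have hr' : -z + -r = -(r + z) := by abel
    rw [hr, hr', hsym, mul_assoc]
    simp only [inner_neg_left, inner_neg_right, add_right_comm]
  simp only [hpt, integral_const_mul]
end

section
/- Let ε ∈ {1, −1}. If ω̃_{R,P}(v, p) = ε · ω̃_{R,P}(p, v) for all R, P, v, p ∈ ℝ^d, then ρ(R, −r; R', r') = ε · ρ(R, r; R', r') for all R, r, R', r' ∈ ℝ^d. -/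
open MeasureTheory
open scoped RealInnerProductSpace
open scoped FourierTransform SchwartzMap

section PhaseSpace

variable {E : Type*} [NormedAddCommGroup E] [InnerProductSpace ℝ E]

/-- The isometry of `E × (E × E)` exchanging the first and the last component. -/
noncomputable def swapOuter (E : Type*) [NormedAddCommGroup E] [InnerProductSpace ℝ E] :
    WithLp 2 (E × WithLp 2 (E × E)) ≃ₗᵢ[ℝ] WithLp 2 (E × WithLp 2 (E × E)) where
  toFun x := WithLp.toLp 2 (x.snd.snd, WithLp.toLp 2 (x.snd.fst, x.fst))
  invFun x := WithLp.toLp 2 (x.snd.snd, WithLp.toLp 2 (x.snd.fst, x.fst))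
  map_add' _ _ := rfl
  map_smul' _ _ := rfl
  left_inv _ := rfl
  right_inv _ := rfl
  norm_map' x := by
    rw [← sq_eq_sq₀ (norm_nonneg _) (norm_nonneg _)]
    simp only [WithLp.prod_norm_sq_eq_of_L2]
    change ‖x.snd.snd‖ ^ 2 + (‖x.snd.fst‖ ^ 2 + ‖x.fst‖ ^ 2) = _
    ring

/-- The linear part of the change of variables defining the Wigner function, acting on
`(r, (Z, z))`. -/
noncomputable def wignerLinear (E : Type*) [NormedAddCommGroup E] [InnerProductSpace ℝ E] :
    WithLp 2 (E × WithLp 2 (E × E)) →ₗ[ℝ] (E × E) × (E × E) where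
  toFun x := ((-x.snd.fst, x.fst - x.snd.snd), (x.snd.fst, x.fst + x.snd.snd))
  map_add' x y := by
    ext <;> simp <;> abel
  map_smul' c x := by
    ext <;> simp [smul_sub]

lemma wignerLinear_injective : Function.Injective (wignerLinear E) := by
  rw [← LinearMap.ker_eq_bot, LinearMap.ker_eq_bot']
  intro x hx
  simp only [wignerLinear, LinearMap.coe_mk, AddHom.coe_mk, Prod.mk_eq_zero, neg_eq_zero] at hx
  obtain ⟨⟨hZ, hs⟩, -, ha⟩ := hx
  have hrz : x.fst = x.snd.snd := sub_eq_zero.1 hs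
  have hz : x.snd.snd = 0 := by
    rw [hrz, ← two_smul ℝ] at ha
    simpa using ha
  apply WithLp.ofLp_injective 2
  refine Prod.ext (hrz.trans hz) ?_
  apply WithLp.ofLp_injective 2
  exact Prod.ext hZ hz

variable [FiniteDimensional ℝ E]

lemma exists_schwartzMap_wigner (ρ : 𝓢((E × E) × (E × E), ℂ)) (R : E) :
    ∃ f : 𝓢(WithLp 2 (E × WithLp 2 (E × E)), ℂ), ∀ x, f x =
      ρ ((R - x.snd.fst, x.fst - x.snd.snd), (R + x.snd.fst, x.fst + x.snd.snd)) := by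
  obtain ⟨K, -, hK⟩ :=
    (wignerLinear E).injective_iff_antilipschitz.1 wignerLinear_injective
  let L := LinearMap.toContinuousLinearMap (wignerLinear E)
  let g : WithLp 2 (E × WithLp 2 (E × E)) → (E × E) × (E × E) :=
    fun x ↦ ((R, 0), (R, 0)) + L x
  have hg : g.HasTemperateGrowth :=
    (Function.HasTemperateGrowth.const _).add L.hasTemperateGrowth
  have hg' : AntilipschitzWith K g := by
    intro x y
    simp only [g, edist_add_left]
    exact hK x y
  refine ⟨SchwartzMap.compCLMOfAntilipschitz ℂ hg hg' ρ, fun x ↦ ?_⟩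
  simp [g, L, wignerLinear, sub_eq_add_neg]

variable [MeasurableSpace E] [BorelSpace E]

lemma fourier_eq_iteratedIntegral (f : 𝓢(WithLp 2 (E × WithLp 2 (E × E)), ℂ))
    (w : WithLp 2 (E × WithLp 2 (E × E))) :
    𝓕 f ((-Real.pi⁻¹) • w) = ∫ r : E, (∫ Z : E, ∫ z : E,
      f (WithLp.toLp 2 (r, WithLp.toLp 2 (Z, z))) *
        Complex.exp (2 * Complex.I * ((⟪w.snd.fst, Z⟫ + ⟪w.snd.snd, z⟫ : ℝ) : ℂ))) *
      Complex.exp (2 * Complex.I * ((⟪w.fst, r⟫ : ℝ) : ℂ)) := by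
  let F : WithLp 2 (E × WithLp 2 (E × E)) → ℂ := fun x ↦
    f x * Complex.exp (2 * Complex.I * ((⟪w, x⟫ : ℝ) : ℂ))
  have hF : Integrable F := by
    refine f.integrable.mul_bdd (c := 1) (by fun_prop) (.of_forall fun x ↦ ?_)
    rw [show 2 * Complex.I * ((⟪w, x⟫ : ℝ) : ℂ) = ((2 * ⟪w, x⟫ : ℝ) : ℂ) * Complex.I by
      push_cast; ring, Complex.norm_exp_ofReal_mul_I]
  let e₁ := (MeasurableEquiv.toLp 2 (E × WithLp 2 (E × E)))
  let e₂ := (MeasurableEquiv.toLp 2 (E × E))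
  have h₁ : MeasurePreserving e₁ := WithLp.volume_preserving_toLp _ _
  have h₂ : MeasurePreserving e₂ := WithLp.volume_preserving_toLp _ _
  have hF₁ : Integrable (F ∘ e₁) (volume.prod volume) :=
    h₁.integrable_comp_of_integrable hF
  calc 𝓕 f ((-Real.pi⁻¹) • w) = ∫ x, F x := by
        rw [SchwartzMap.fourier_coe, Real.fourier_eq']
        refine integral_congr_ae (.of_forall fun x ↦ ?_)
        simp only [F, smul_eq_mul, inner_smul_right, real_inner_comm w x]
        rw [mul_comm]
        congr 2
        push_cast
        field_simp
    _ = ∫ y, F (e₁ y) := (h₁.integral_comp' F).symm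
    _ = ∫ r : E, ∫ u : WithLp 2 (E × E), F (e₁ (r, u)) := integral_prod _ hF₁
    _ = _ := by
        refine integral_congr_ae ?_
        filter_upwards [hF₁.prod_right_ae] with r hr
        have hr' : Integrable (fun y ↦ F (e₁ (r, e₂ y))) (volume.prod volume) :=
          h₂.integrable_comp_of_integrable hr
        rw [← h₂.integral_comp' (fun u ↦ F (e₁ (r, u)))]
        refine (integral_prod _ hr').trans ?_
        simp only [← integral_mul_const]
        refine integral_congr_ae (.of_forall fun Z ↦ integral_congr_ae (.of_forall fun z ↦ ?_))
        simp only [F, e₁, e₂, MeasurableEquiv.coe_toLp, WithLp.prod_inner_apply, mul_assoc,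
          ← Complex.exp_add]
        congr 2
        simp only [WithLp.ofLp_fst, WithLp.ofLp_snd]
        push_cast
        ring

end PhaseSpace

/-- Converse direction: if the intracule partial Fourier transform of the Wigner
function of ρ satisfies ω̃_{R,P}(v, p) = ε·ω̃_{R,P}(p, v) for all R, P, v, p,
then ρ is symmetric (ε = 1) resp. antisymmetric (ε = -1) under exchange of the
two particles in its first (unprimed) set of variables. -/
theorem stmt_2 (d : ℕ) (hd : 1 ≤ d) (ε : ℂ) (hε : ε = 1 ∨ ε = -1)
(ρ : SchwartzMap ((EuclideanSpace ℝ (Fin d) × EuclideanSpace ℝ (Fin d)) ×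
      (EuclideanSpace ℝ (Fin d) × EuclideanSpace ℝ (Fin d))) ℂ)
    (W : EuclideanSpace ℝ (Fin d) → EuclideanSpace ℝ (Fin d) →
      EuclideanSpace ℝ (Fin d) → EuclideanSpace ℝ (Fin d) → ℂ)
    (hW : ∀ R r P p, W R r P p =
      ((Real.pi : ℂ) ^ (2 * d))⁻¹ *
        ∫ Z : EuclideanSpace ℝ (Fin d), ∫ z : EuclideanSpace ℝ (Fin d),
          ρ ((R - Z, r - z), (R + Z, r + z)) *
            Complex.exp (2 * Complex.I * ((⟪P, Z⟫ + ⟪p, z⟫ : ℝ) : ℂ)))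
    (ω : EuclideanSpace ℝ (Fin d) → EuclideanSpace ℝ (Fin d) →
      EuclideanSpace ℝ (Fin d) → EuclideanSpace ℝ (Fin d) → ℂ)
    (hω : ∀ R P v p, ω R P v p =
      ∫ r : EuclideanSpace ℝ (Fin d),
        W R r P p * Complex.exp (2 * Complex.I * ((⟪v, r⟫ : ℝ) : ℂ)))
    (hsym : ∀ R P v p, ω R P v p = ε * ω R P p v) :
    ∀ R r R' r', ρ ((R, -r), (R', r')) = ε * ρ ((R, r), (R', r')) := by
  have key : ∀ R r Z z : EuclideanSpace ℝ (Fin d), ρ ((R - Z, r - z), (R + Z, r + z)) =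
      ε * ρ ((R - Z, z - r), (R + Z, z + r)) := by
    intro R
    obtain ⟨f, hf⟩ := exists_schwartzMap_wigner ρ R
    let σ := swapOuter (EuclideanSpace ℝ (Fin d))
    let f' := SchwartzMap.compCLMOfContinuousLinearEquiv ℂ σ.toContinuousLinearEquiv f
    have hf' (w) : 𝓕 f' w = 𝓕 f (σ w) :=
      Real.fourier_comp_linearIsometry σ f w
    have hωf (w) : ω R w.snd.fst w.fst w.snd.snd =
        ((Real.pi : ℂ) ^ (2 * d))⁻¹ * 𝓕 f ((-Real.pi⁻¹) • w) := by
      simp only [hω, hW, fourier_eq_iteratedIntegral, hf, WithLp.toLp_fst, WithLp.toLp_snd,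
        mul_assoc ((Real.pi : ℂ) ^ (2 * d))⁻¹, integral_const_mul]
    have hfourier : 𝓕 f = 𝓕 (ε • f') := by
      ext w
      obtain ⟨w, rfl⟩ : ∃ u, (-Real.pi⁻¹) • u = w :=
        ⟨(-Real.pi⁻¹)⁻¹ • w, smul_inv_smul₀ (by simp [Real.pi_ne_zero]) w⟩
      rw [FourierTransform.fourier_smul, smul_apply, hf', σ.map_smul, smul_eq_mul]
      have h := hsym R w.snd.fst w.fst w.snd.snd
      have h' := hωf (σ w)
      change ω R w.snd.fst w.snd.snd w.fst = _ at h'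
      rw [hωf, h', mul_left_comm] at h
      exact mul_left_cancel₀ (inv_ne_zero (pow_ne_zero _ (by simp [Real.pi_ne_zero]))) h
    have hff' : f = ε • f' :=
      (FourierTransform.fourierCLE ℂ (SchwartzMap _ ℂ)).injective hfourier
    intro r Z z
    have h := DFunLike.congr_fun hff' (WithLp.toLp 2 (r, WithLp.toLp 2 (Z, z)))
    rw [smul_apply, hf] at h
    refine h.trans (congrArg (ε * ·) (hf _))
  intro R r R' r'
  have h := key ((1 / 2 : ℝ) • (R + R')) ((1 / 2 : ℝ) • (r' - r)) ((1 / 2 : ℝ) • (R' - R))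
    ((1 / 2 : ℝ) • (r' + r))
  rw [show (1 / 2 : ℝ) • (R + R') - (1 / 2 : ℝ) • (R' - R) = R by module,
    show (1 / 2 : ℝ) • (R + R') + (1 / 2 : ℝ) • (R' - R) = R' by module,
    show (1 / 2 : ℝ) • (r' - r) - (1 / 2 : ℝ) • (r' + r) = -r by module,
    show (1 / 2 : ℝ) • (r' - r) + (1 / 2 : ℝ) • (r' + r) = r' by module,
    show (1 / 2 : ℝ) • (r' + r) - (1 / 2 : ℝ) • (r' - r) = r by module,
    show (1 / 2 : ℝ) • (r' + r) + (1 / 2 : ℝ) • (r' - r) = r' by module] at h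
  exact h
end

section
/- Let ε ∈ {1, −1}. If ω̃_{R,P}(v, p) = ε · ω̃_{R,P}(−p, −v) for all R, P, v, p ∈ ℝ^d, then ρ(R, r; R', −r') = ε · ρ(R, r; R', r') for all R, r, R', r' ∈ ℝ^d. -/
open MeasureTheory
open scoped RealInnerProductSpace
section WignerFourier

variable {E : Type*} [NormedAddCommGroup E] [InnerProductSpace ℝ E]

/-- The intracule/extracule points `((R - Z, r - z), (R + Z, r + z))` as a function
of `(r, Z, z)`. -/
def wignerPoint (R : E) (x : E × E × E) : (E × E) × (E × E) :=
  ((R - x.2.1, x.1 - x.2.2), (R + x.2.1, x.1 + x.2.2))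

/-- The exchange `(r, Z, z) ↦ (-z, Z, -r)`. -/
def intraculeExchange (x : E × E × E) : E × E × E := (-x.2.2, x.2.1, -x.1)

/-- The phase of the combined Wigner and intracule Fourier transforms. -/
noncomputable def wignerPhase (v P p : E) (x : E × E × E) : ℂ :=
  Complex.exp (2 * Complex.I * ((⟪v, x.1⟫ + (⟪P, x.2.1⟫ + ⟪p, x.2.2⟫) : ℝ) : ℂ))

lemma continuous_wignerPhase (v P p : E) : Continuous (wignerPhase v P p) := by
  unfold wignerPhase
  fun_prop

lemma norm_wignerPhase (v P p : E) (x : E × E × E) : ‖wignerPhase v P p x‖ = 1 := by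
  rw [wignerPhase, mul_comm (2 : ℂ), mul_assoc, mul_comm Complex.I]
  exact_mod_cast Complex.norm_exp_ofReal_mul_I _

lemma wignerPhase_exchange (v P p : E) (x : E × E × E) :
    wignerPhase (-p) P (-v) (intraculeExchange x) = wignerPhase v P p x := by
  simp only [wignerPhase, intraculeExchange, inner_neg_neg]
  congr 3
  ring

lemma hasTemperateGrowth_wignerPoint (R : E) : (wignerPoint R).HasTemperateGrowth := by
  have h : wignerPoint R = fun x : E × E × E =>
      ((((-(ContinuousLinearMap.fst ℝ E E ∘L .snd ℝ E (E × E))).prod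
        (.fst ℝ E (E × E) - .snd ℝ E E ∘L .snd ℝ E (E × E))).prod
        ((ContinuousLinearMap.fst ℝ E E ∘L .snd ℝ E (E × E)).prod
        (.fst ℝ E (E × E) + .snd ℝ E E ∘L .snd ℝ E (E × E)))) x) + ((R, 0), (R, 0)) := by
    ext x <;> simp [wignerPoint, sub_eq_neg_add, add_comm]
  rw [h]
  fun_prop

lemma antilipschitzWith_wignerPoint (R : E) : AntilipschitzWith 1 (wignerPoint R) := by
  refine AntilipschitzWith.of_le_mul_dist fun x y => ?_
  have key (a b : E) (M : ℝ) (h₁ : ‖a - b‖ ≤ M) (h₂ : ‖a + b‖ ≤ M) : ‖a‖ ≤ M ∧ ‖b‖ ≤ M := by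
    have ha : ‖(2 : ℝ) • a‖ ≤ ‖a - b‖ + ‖a + b‖ := by
      convert norm_add_le (a - b) (a + b) using 1
      congr 1
      module
    have hb : ‖(2 : ℝ) • b‖ ≤ ‖a + b‖ + ‖a - b‖ := by
      convert norm_sub_le (a + b) (a - b) using 1
      congr 1
      module
    rw [norm_smul, Real.norm_two] at ha hb
    constructor <;> linarith
  set M := dist (wignerPoint R x) (wignerPoint R y) with hM
  have e : wignerPoint R x - wignerPoint R y = ((-(x.2.1 - y.2.1), (x.1 - y.1) - (x.2.2 - y.2.2)),
      (x.2.1 - y.2.1, (x.1 - y.1) + (x.2.2 - y.2.2))) := by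
    ext <;> simp only [wignerPoint, Prod.fst_sub, Prod.snd_sub] <;> abel
  rw [dist_eq_norm, e] at hM
  have h₁ : ‖(x.1 - y.1) - (x.2.2 - y.2.2)‖ ≤ M := by
    rw [hM, Prod.norm_mk, Prod.norm_mk]
    exact (le_max_right _ _).trans (le_max_left _ _)
  have h₂ : ‖(x.1 - y.1) + (x.2.2 - y.2.2)‖ ≤ M := by
    rw [hM, Prod.norm_mk, Prod.norm_mk (x.2.1 - y.2.1)]
    exact (le_max_right _ _).trans (le_max_right _ _)
  have h₃ : ‖x.2.1 - y.2.1‖ ≤ M := by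
    rw [hM, Prod.norm_mk, Prod.norm_mk (x.2.1 - y.2.1)]
    exact (le_max_left _ _).trans (le_max_right _ _)
  obtain ⟨h₄, h₅⟩ := key _ _ M h₁ h₂
  rw [NNReal.coe_one, one_mul, dist_eq_norm]
  exact norm_prod_le_iff.2 ⟨h₄, norm_prod_le_iff.2 ⟨h₃, h₅⟩⟩

variable [FiniteDimensional ℝ E] [MeasurableSpace E] [BorelSpace E]

/-- A continuous integrable function with vanishing Fourier transform is zero. -/
lemma eq_zero_of_forall_integral_mul_exp_eq_zero {f : E → ℂ} (hc : Continuous f)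
    (hi : Integrable f)
    (h : ∀ w : E, ∫ x, f x * Complex.exp (2 * Complex.I * ((⟪w, x⟫ : ℝ) : ℂ)) = 0) : f = 0 := by
  have hF : FourierTransform.fourier f = (0 : E → ℂ) := by
    ext w
    rw [Real.fourier_eq', Pi.zero_apply, ← h (-Real.pi • w)]
    congr 1 with x
    rw [smul_eq_mul, mul_comm, inner_smul_left, real_inner_comm]
    congr 2
    simp
    ring
  have hinv := hc.fourierInv_fourier_eq hi (by rw [hF]; exact integrable_zero _ _ _)
  rw [← hinv, hF]
  ext w
  simp [Real.fourierInv_eq']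

/-- The vanishing criterion for Fourier transforms on a triple product. -/
lemma eq_zero_of_forall_integral_mul_wignerPhase_eq_zero {f : E × E × E → ℂ}
    (hc : Continuous f) (hi : Integrable f)
    (h : ∀ v P p : E, ∫ x, f x * wignerPhase v P p x = 0) : f = 0 := by
  let e : WithLp 2 (E × WithLp 2 (E × E)) ≃ₜ E × E × E :=
    (WithLp.homeomorphProd 2 E (WithLp 2 (E × E))).trans
      ((Homeomorph.refl E).prodCongr (WithLp.homeomorphProd 2 E E))
  have he : MeasurePreserving e :=
    ((MeasurePreserving.id volume).prod (WithLp.volume_preserving_ofLp E E)).comp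
      (WithLp.volume_preserving_ofLp E (WithLp 2 (E × E)))
  have hme : MeasurableEmbedding e := e.measurableEmbedding
  have hz : f ∘ e = 0 := by
    refine eq_zero_of_forall_integral_mul_exp_eq_zero (hc.comp e.continuous)
      ((he.integrable_comp_emb hme).2 hi) fun w => ?_
    rw [← h w.fst w.snd.fst w.snd.snd, ← he.integral_comp hme]
    rfl
  ext x
  simpa using congrFun hz (e.symm x)

lemma measurePreserving_intraculeExchange :
    MeasurePreserving (intraculeExchange : E × E × E → E × E × E) := by
  have hn : MeasurePreserving (fun x : E => -x) := Measure.measurePreserving_neg volume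
  have h₁ : MeasurePreserving (Prod.map (id : E → E) (Prod.swap : E × E → E × E)) :=
    (MeasurePreserving.id volume).prod Measure.measurePreserving_swap
  have h₂ : MeasurePreserving (MeasurableEquiv.prodAssoc : (E × E) × E ≃ᵐ E × E × E) :=
    volume_preserving_prodAssoc
  have h₃ : MeasurePreserving (Prod.swap : E × (E × E) → (E × E) × E) :=
    Measure.measurePreserving_swap
  have h₄ : MeasurePreserving
      (Prod.map (fun x : E => -x) (Prod.map (id : E → E) fun x : E => -x)) :=
    hn.prod ((MeasurePreserving.id volume).prod hn)
  exact h₄.comp (h₂.comp (h₃.comp h₁))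

lemma measurableEmbedding_intraculeExchange :
    MeasurableEmbedding (intraculeExchange : E × E × E → E × E × E) :=
  (show Continuous (intraculeExchange : E × E × E → E × E × E) by
    unfold intraculeExchange; fun_prop).measurableEmbedding fun x y h => by
      simp only [intraculeExchange, Prod.mk.injEq, neg_inj] at h
      ext1
      · exact h.2.2
      · exact Prod.ext h.2.1 h.1

lemma integrable_comp_wignerPoint (ρ : SchwartzMap ((E × E) × (E × E)) ℂ) (R : E) :
    Integrable fun x => ρ (wignerPoint R x) := by
  have : (volume : Measure (E × E)).IsAddHaarMeasure :=
    Measure.prod.instIsAddHaarMeasure _ _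
  have : (volume : Measure (E × E × E)).IsAddHaarMeasure :=
    Measure.prod.instIsAddHaarMeasure _ _
  exact (SchwartzMap.compCLMOfAntilipschitz ℝ (hasTemperateGrowth_wignerPoint R)
    (antilipschitzWith_wignerPoint R) ρ).integrable

lemma integrable_mul_wignerPhase {f : E × E × E → ℂ} (hf : Integrable f) (v P p : E) :
    Integrable fun x => f x * wignerPhase v P p x :=
  hf.mul_bdd (c := 1) (continuous_wignerPhase v P p).aestronglyMeasurable
    (.of_forall fun x => (norm_wignerPhase v P p x).le)

/-- The iterated transforms are a single Fourier integral over `(r, Z, z)`. -/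
lemma integral_wigner_eq (ρ : SchwartzMap ((E × E) × (E × E)) ℂ) (c : ℂ) (R P v p : E) :
    ∫ r : E, (c * ∫ Z : E, ∫ z : E, ρ ((R - Z, r - z), (R + Z, r + z)) *
        Complex.exp (2 * Complex.I * ((⟪P, Z⟫ + ⟪p, z⟫ : ℝ) : ℂ))) *
          Complex.exp (2 * Complex.I * ((⟪v, r⟫ : ℝ) : ℂ)) =
      c * ∫ x, ρ (wignerPoint R x) * wignerPhase v P p x := by
  have hi := integrable_mul_wignerPhase (integrable_comp_wignerPoint ρ R) v P p
  rw [Measure.volume_eq_prod] at hi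
  rw [Measure.volume_eq_prod, integral_prod _ hi, ← integral_const_mul]
  refine integral_congr_ae ?_
  filter_upwards [hi.prod_right_ae] with r hr
  rw [Measure.volume_eq_prod] at hr ⊢
  rw [integral_prod _ hr, mul_assoc, ← integral_mul_const]
  congr 2 with Z
  rw [← integral_mul_const]
  congr 1 with z
  rw [mul_assoc, ← Complex.exp_add, wignerPhase, wignerPoint]
  congr 2
  push_cast
  ring

end WignerFourier

/-- Converse direction: if the intracule partial Fourier transform of the Wigner
function of ρ satisfies ω̃_{R,P}(v, p) = ε·ω̃_{R,P}(-p, -v) for all R, P, v, p,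
then ρ is symmetric (ε = 1) resp. antisymmetric (ε = -1) under exchange of the
two particles in its second (primed) set of variables. -/
theorem stmt_3 (d : ℕ) (hd : 1 ≤ d) (ε : ℂ) (hε : ε = 1 ∨ ε = -1)
(ρ : SchwartzMap ((EuclideanSpace ℝ (Fin d) × EuclideanSpace ℝ (Fin d)) ×
      (EuclideanSpace ℝ (Fin d) × EuclideanSpace ℝ (Fin d))) ℂ)
    (W : EuclideanSpace ℝ (Fin d) → EuclideanSpace ℝ (Fin d) →
      EuclideanSpace ℝ (Fin d) → EuclideanSpace ℝ (Fin d) → ℂ)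
    (hW : ∀ R r P p, W R r P p =
      ((Real.pi : ℂ) ^ (2 * d))⁻¹ *
        ∫ Z : EuclideanSpace ℝ (Fin d), ∫ z : EuclideanSpace ℝ (Fin d),
          ρ ((R - Z, r - z), (R + Z, r + z)) *
            Complex.exp (2 * Complex.I * ((⟪P, Z⟫ + ⟪p, z⟫ : ℝ) : ℂ)))
    (ω : EuclideanSpace ℝ (Fin d) → EuclideanSpace ℝ (Fin d) →
      EuclideanSpace ℝ (Fin d) → EuclideanSpace ℝ (Fin d) → ℂ)
    (hω : ∀ R P v p, ω R P v p =
      ∫ r : EuclideanSpace ℝ (Fin d),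
        W R r P p * Complex.exp (2 * Complex.I * ((⟪v, r⟫ : ℝ) : ℂ)))
    (hsym : ∀ R P v p, ω R P v p = ε * ω R P (-p) (-v)) :
    ∀ R r R' r', ρ ((R, r), (R', -r')) = ε * ρ ((R, r), (R', r')) := by
  intro R r R' r'
  let R₀ := (2⁻¹ : ℝ) • (R + R')
  have hρ : Continuous fun x => ρ (wignerPoint R₀ x) :=
    ρ.continuous.comp (by unfold wignerPoint; fun_prop)
  have hσ : Continuous (intraculeExchange (E := EuclideanSpace ℝ (Fin d))) := by
    unfold intraculeExchange
    fun_prop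
  have hi := integrable_comp_wignerPoint ρ R₀
  have hi' : Integrable fun x => ρ (wignerPoint R₀ (intraculeExchange x)) :=
    (measurePreserving_intraculeExchange.integrable_comp_emb
      measurableEmbedding_intraculeExchange).2 hi
  have hzero : (fun x => ρ (wignerPoint R₀ x) -
      ε * ρ (wignerPoint R₀ (intraculeExchange x))) = 0 := by
    refine eq_zero_of_forall_integral_mul_wignerPhase_eq_zero
      (hρ.sub ((hρ.comp hσ).const_mul ε)) (hi.sub (hi'.const_mul ε)) fun v P p => ?_
    have hs := hsym R₀ P v p
    simp only [hω, hW, integral_wigner_eq] at hs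
    rw [mul_left_comm, ← measurePreserving_intraculeExchange.integral_comp
      measurableEmbedding_intraculeExchange
      (fun x => ρ (wignerPoint R₀ x) * wignerPhase (-p) P (-v) x)] at hs
    simp only [wignerPhase_exchange] at hs
    replace hs := mul_left_cancel₀ (inv_ne_zero (pow_ne_zero _
      (Complex.ofReal_ne_zero.2 Real.pi_ne_zero))) hs
    simp only [sub_mul, mul_assoc]
    rw [integral_sub (integrable_mul_wignerPhase hi v P p)
      ((integrable_mul_wignerPhase hi' v P p).const_mul ε), integral_const_mul, hs, sub_self]
  let x := ((2⁻¹ : ℝ) • (r - r'), (2⁻¹ : ℝ) • (R' - R), -((2⁻¹ : ℝ) • (r + r')))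
  have h₁ : wignerPoint R₀ x = ((R, r), (R', -r')) := by
    simp only [wignerPoint, x, R₀, Prod.mk.injEq]
    refine ⟨⟨?_, ?_⟩, ?_, ?_⟩ <;> module
  have h₂ : wignerPoint R₀ (intraculeExchange x) = ((R, r), (R', r')) := by
    simp only [wignerPoint, intraculeExchange, x, R₀, Prod.mk.injEq]
    refine ⟨⟨?_, ?_⟩, ?_, ?_⟩ <;> module
  have h := sub_eq_zero.1 (congrFun hzero x)
  rwa [h₁, h₂] at h
end

section
/- Let d_j, d_k > 0 and b_j, b_k ∈ ℝ, and set ψ_j(x) := (d_j/π)^{1/4} · exp(−(d_j/2)x² − (i/2) b_j d_j x²) and likewise ψ_k. Define the complex constants d_{jk} := (d_j + d_k)/2 + (i/2)(b_j d_j − b_k d_k), b_{jk} := (b_j d_j + b_k d_k)/2 − (i/2)(d_j − d_k), A_{jk} := d_{jk} + b_{jk}²/d_{jk}, and B_{jk} := b_{jk}/d_{jk} (note Re d_{jk} > 0). Then for all x, p ∈ ℝ: (1/π) ∫_ℝ ψ_j(x − z) · conj(ψ_k(x + z)) · exp(2ipz) dz = (d_j d_k)^{1/4} / (π · √(d_{jk}))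 · exp(−A_{jk} x² − 2 B_{jk} x p − p²/d_{jk}), where √(d_{jk}) denotes the principal branch of the complex square root. -/
open MeasureTheory

/-- The principal square root of `a / w` splits for `a ≥ 0` and `w` in the right half-plane. -/
theorem Complex.ofReal_div_cpow_half {a : ℝ} (ha : 0 ≤ a) {w : ℂ} (hw : 0 < w.re) :
    ((a : ℂ) / w) ^ ((1 : ℂ) / 2) = ((a ^ ((1 : ℝ) / 2) : ℝ) : ℂ) / w ^ ((1 : ℂ) / 2) := by
  have harg : w.arg ≠ Real.pi := fun h => by
    have := (Complex.arg_eq_pi_iff.mp h).1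
    linarith
  have hw0 : w ≠ 0 := by
    rintro rfl
    simp at hw
  rcases ha.eq_or_lt with rfl | ha
  · simp
  · rw [div_eq_mul_inv _ w, Complex.cpow_def_of_ne_zero
      (mul_ne_zero (Complex.ofReal_ne_zero.mpr ha.ne') (inv_ne_zero hw0)),
      Complex.log_ofReal_mul ha (inv_ne_zero hw0), add_mul, Complex.exp_add, div_eq_mul_inv _ (w ^ _),
      ← Complex.inv_cpow _ _ harg, Complex.cpow_def_of_ne_zero (inv_ne_zero hw0),
      Real.rpow_def_of_pos ha]
    push_cast
    rfl

/-- Normalization constant of a product of two one-dimensional Gaussians. -/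
theorem Real.div_pi_rpow_quarter_mul {a b : ℝ} (ha : 0 ≤ a) (hb : 0 ≤ b) :
    (a / Real.pi) ^ ((1 : ℝ) / 4) * (b / Real.pi) ^ ((1 : ℝ) / 4) * Real.pi ^ ((1 : ℝ) / 2) =
      (a * b) ^ ((1 : ℝ) / 4) := by
  have h : Real.pi ^ ((1 : ℝ) / 2) = Real.pi ^ ((1 : ℝ) / 4) * Real.pi ^ ((1 : ℝ) / 4) := by
    rw [← Real.rpow_add Real.pi_pos]
    norm_num
  have h0 : Real.pi ^ ((1 : ℝ) / 4) ≠ 0 := (Real.rpow_pos_of_pos Real.pi_pos _).ne'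
  rw [Real.div_rpow ha Real.pi_pos.le, Real.div_rpow hb Real.pi_pos.le, Real.mul_rpow ha hb, h]
  field_simp

/-- The Wigner interference term of two centered complex Gaussians
ψ_j(x) = (d_j/π)^{1/4} exp(−(d_j/2)x² − (i/2)b_j d_j x²) is the complex Gaussian
W_{jk}(x, p) = (d_j d_k)^{1/4}/(π √d_{jk}) · exp(−A_{jk}x² − 2B_{jk}xp − p²/d_{jk}),
with d_{jk}, b_{jk}, A_{jk}, B_{jk} as in the paper and √ the principal branch. -/
theorem stmt_9 (dj dk : ℝ) (hdj : 0 < dj) (hdk : 0 < dk) (bj bk : ℝ)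
    (ψj ψk : ℝ → ℂ)
    (hψj : ∀ x : ℝ, ψj x = (((dj / Real.pi) ^ ((1 : ℝ) / 4) : ℝ) : ℂ) *
      Complex.exp (-((dj : ℂ) / 2) * (x : ℂ) ^ 2 -
        (Complex.I / 2) * (bj : ℂ) * (dj : ℂ) * (x : ℂ) ^ 2))
    (hψk : ∀ x : ℝ, ψk x = (((dk / Real.pi) ^ ((1 : ℝ) / 4) : ℝ) : ℂ) *
      Complex.exp (-((dk : ℂ) / 2) * (x : ℂ) ^ 2 -
        (Complex.I / 2) * (bk : ℂ) * (dk : ℂ) * (x : ℂ) ^ 2))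
    (djk bjk Ajk Bjk : ℂ)
    (hdjk : djk = ((dj : ℂ) + dk) / 2 + (Complex.I / 2) * ((bj : ℂ) * dj - (bk : ℂ) * dk))
    (hbjk : bjk = ((bj : ℂ) * dj + (bk : ℂ) * dk) / 2 - (Complex.I / 2) * ((dj : ℂ) - dk))
    (hAjk : Ajk = djk + bjk ^ 2 / djk)
    (hBjk : Bjk = bjk / djk) :
    ∀ x p : ℝ,
      (1 / (Real.pi : ℂ)) *
          ∫ z : ℝ, ψj (x - z) * (starRingEnd ℂ) (ψk (x + z)) *
            Complex.exp (2 * Complex.I * (p : ℂ) * (z : ℂ)) =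
      ((((dj * dk) ^ ((1 : ℝ) / 4) : ℝ) : ℂ) / ((Real.pi : ℂ) * djk ^ ((1 : ℂ) / 2))) *
        Complex.exp (-Ajk * (x : ℂ) ^ 2 - 2 * Bjk * (x : ℂ) * (p : ℂ) - (p : ℂ) ^ 2 / djk) := by
  intro x p
  have hre : 0 < djk.re := by
    rw [hdjk]
    simp
    linarith
  have h0 : djk ≠ 0 := by
    rintro h
    simp [h] at hre
  have hint : ∀ z : ℝ, ψj (x - z) * (starRingEnd ℂ) (ψk (x + z)) *
      Complex.exp (2 * Complex.I * (p : ℂ) * (z : ℂ)) =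
      (((dj / Real.pi) ^ ((1 : ℝ) / 4) * (dk / Real.pi) ^ ((1 : ℝ) / 4) : ℝ) : ℂ) *
        Complex.exp (-djk * (z : ℂ) ^ 2 + 2 * Complex.I * (bjk * x + p) * z +
          -djk * (x : ℂ) ^ 2) := by
    intro z
    have hexp : -djk * (z : ℂ) ^ 2 + 2 * Complex.I * (bjk * x + p) * z + -djk * (x : ℂ) ^ 2 =
        (-((dj : ℂ) / 2) * ((x - z : ℝ) : ℂ) ^ 2 -
          (Complex.I / 2) * (bj : ℂ) * (dj : ℂ) * ((x - z : ℝ) : ℂ) ^ 2) +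
        (starRingEnd ℂ) (-((dk : ℂ) / 2) * ((x + z : ℝ) : ℂ) ^ 2 -
          (Complex.I / 2) * (bk : ℂ) * (dk : ℂ) * ((x + z : ℝ) : ℂ) ^ 2) +
        2 * Complex.I * (p : ℂ) * (z : ℂ) := by
      simp only [map_sub, map_mul, map_neg, map_div₀, map_pow, Complex.conj_ofReal,
        Complex.conj_I, map_ofNat, hdjk, hbjk]
      push_cast
      linear_combination ((dk : ℂ) - dj) * x * z * Complex.I_sq
    rw [hψj, hψk, hexp, Complex.exp_add, Complex.exp_add, Complex.exp_conj, map_mul,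
      Complex.conj_ofReal, Complex.ofReal_mul]
    ring
  simp_rw [hint]
  rw [integral_const_mul, integral_cexp_quadratic (by simpa using hre), neg_neg,
    Complex.ofReal_div_cpow_half Real.pi_pos.le hre,
    ← Real.div_pi_rpow_quarter_mul hdj.le hdk.le, Complex.ofReal_mul _ (Real.pi ^ _)]
  have hexp : -djk * (x : ℂ) ^ 2 - (2 * Complex.I * (bjk * x + p)) ^ 2 / (4 * -djk) =
      -Ajk * (x : ℂ) ^ 2 - 2 * Bjk * (x : ℂ) * (p : ℂ) - (p : ℂ) ^ 2 / djk := by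
    rw [hAjk, hBjk]
    field_simp
    linear_combination 4 * (bjk * x + p) ^ 2 * Complex.I_sq
  rw [hexp]
  ring
end

section
/- Fix μ > 0 and m ∈ ℕ, and let φ_m(r) := (μ/π)^{1/4} (2^m m!)^{−1/2} H_m(√μ · r) · exp(−μ r²/2) be the m-th normalized harmonic-oscillator eigenfunction of frequency μ, where H_m is the m-th physicists' Hermite polynomial. Then for all r, p ∈ ℝ: (1/π) ∫_ℝ φ_m(r − z) · φ_m(r + z) · exp(2ipz) dz = ((−1)^m/π) · L_m(4H(r,p)/μ) · exp(−2H(r,p)/μ), where H(r, p) := p²/2 + μ² r²/2 and L_m(t) := ∑_{k=0}^{m} (binomial(m, k)/k!) · (−t)^k is the m-th Laguerre polynomial. -/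
open MeasureTheory Polynomial

/-- The `n`-th physicists' Hermite polynomial, translated by `a`: the polynomial `Hₙ(X + a)`. -/
noncomputable def shiftedHermite {R : Type*} [CommRing R] (a : R) : ℕ → R[X]
  | 0 => 1
  | n + 1 => C 2 * (X + C a) * shiftedHermite a n - derivative (shiftedHermite a n)

theorem derivative_shiftedHermite_succ {R : Type*} [CommRing R] (a : R) (n : ℕ) :
    derivative (shiftedHermite a (n + 1)) = C (2 * (n + 1 : R)) * shiftedHermite a n := by
  induction n with
  | zero => simp [shiftedHermite]
  | succ n ih =>
    rw [shiftedHermite, derivative_sub, derivative_mul, ih]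
    rw [derivative_mul, derivative_C]
    conv_rhs => rw [shiftedHermite]
    simp
    have h := shiftedHermite.eq_2 a n
    simp only [map_ofNat] at h ⊢
    linear_combination 2 * h

theorem iterate_derivative_shiftedHermite {R : Type*} [CommRing R] (a : R) (n k : ℕ) :
    derivative^[k] (shiftedHermite a n) =
      C (2 ^ k * (n.descFactorial k : R)) * shiftedHermite a (n - k) := by
  induction k with
  | zero => simp
  | succ k ih =>
    rw [Function.iterate_succ_apply', ih, derivative_C_mul, Nat.descFactorial_succ]
    rcases h : n - k with _ | j
    · simp [shiftedHermite]
    · rw [derivative_shiftedHermite_succ, show n - (k + 1) = j by omega]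
      simp
      ring

theorem map_shiftedHermite {R S : Type*} [CommRing R] [CommRing S] (f : R →+* S) (a : R) (n : ℕ) :
    (shiftedHermite a n).map f = shiftedHermite (f a) n := by
  induction n with
  | zero => simp [shiftedHermite]
  | succ n ih => simp [shiftedHermite, ← ih, derivative_map, map_ofNat]

theorem iteratedDeriv_gaussian (a : ℝ) (n : ℕ) (s : ℝ) :
    iteratedDeriv n (fun y : ℝ => Real.exp (-y ^ 2)) (s + a) =
      (-1) ^ n * (shiftedHermite a n).eval s * Real.exp (-(s + a) ^ 2) := by
  rw [← congrFun (iteratedDeriv_comp_add_const n _ a) s]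
  induction n generalizing s with
  | zero => simp [shiftedHermite]
  | succ n ih =>
    rw [iteratedDeriv_succ, funext ih]
    have h : HasDerivAt (fun s : ℝ => Real.exp (-(s + a) ^ 2))
        (Real.exp (-(s + a) ^ 2) * (-(2 * (s + a)))) s := by
      have := ((((hasDerivAt_id s).add_const a).pow 2).neg).exp
      convert! this using 1
      simp
    rw [((((shiftedHermite a n).hasDerivAt s).const_mul ((-1) ^ n)).fun_mul h).deriv]
    simp [shiftedHermite]
    ring

theorem integrable_pow_mul_cexp (q : ℝ) (n : ℕ) :
    Integrable fun s : ℝ => (s : ℂ) ^ n *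
      Complex.exp (-(s : ℂ) ^ 2 + 2 * Complex.I * q * s) := by
  have h := integrable_rpow_mul_exp_neg_mul_sq (b := 1) one_pos (s := n)
    (by have : (0 : ℝ) ≤ n := n.cast_nonneg
        linarith)
  refine h.mono (by fun_prop) (.of_forall fun s => le_of_eq ?_)
  simp [Complex.norm_exp, ← Complex.ofReal_pow]

theorem integrable_eval_mul_cexp (q : ℝ) (P : ℂ[X]) :
    Integrable fun s : ℝ => P.eval (s : ℂ) *
      Complex.exp (-(s : ℂ) ^ 2 + 2 * Complex.I * q * s) := by
  induction P using Polynomial.induction_on' with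
  | add P Q hP hQ =>
    simp only [eval_add, add_mul]
    exact hP.add hQ
  | monomial n c => simpa [mul_assoc] using (integrable_pow_mul_cexp q n).const_mul c

/-- Integration of polynomials against the modulated Gaussian `exp (-s² + 2iqs)`. -/
noncomputable def gaussianFourierFunctional (q : ℝ) : ℂ[X] →ₗ[ℂ] ℂ where
  toFun P := ∫ s : ℝ, P.eval (s : ℂ) * Complex.exp (-(s : ℂ) ^ 2 + 2 * Complex.I * q * s)
  map_add' P Q := by
    simp only [eval_add, add_mul]
    exact integral_add (integrable_eval_mul_cexp q P) (integrable_eval_mul_cexp q Q)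
  map_smul' c P := by
    simp only [eval_smul, smul_eq_mul, mul_assoc, integral_const_mul, RingHom.id_apply]

theorem gaussianFourierFunctional_one (q : ℝ) :
    gaussianFourierFunctional q 1 = (Real.sqrt Real.pi : ℂ) * Complex.exp (-(q : ℂ) ^ 2) := by
  have h := fourierIntegral_gaussian (b := 1) (by simp) (2 * (q : ℂ))
  rw [Real.sqrt_eq_rpow, Complex.ofReal_cpow Real.pi_pos.le]
  convert! h using 1
  · simp only [gaussianFourierFunctional, LinearMap.coe_mk, AddHom.coe_mk, ← Complex.exp_add,
      eval_one, one_mul]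
    congr! 3
    ring
  · push_cast
    congr 2
    · simp
    · ring

theorem gaussianFourierFunctional_derivative (q : ℝ) (P : ℂ[X]) :
    gaussianFourierFunctional q (derivative P) =
      gaussianFourierFunctional q (C 2 * (X - C (Complex.I * q)) * P) := by
  rw [← sub_eq_zero, ← map_sub]
  refine integral_eq_zero_of_hasDerivAt_of_integrable (fun s => ?_)
    (integrable_eval_mul_cexp q _) (integrable_eval_mul_cexp q P)
  have h : HasDerivAt (fun s : ℂ => Complex.exp (-s ^ 2 + 2 * Complex.I * q * s))
      (Complex.exp (-(s : ℂ) ^ 2 + 2 * Complex.I * q * s) * (-(2 * s) + 2 * Complex.I * q))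
      (s : ℂ) := by
    have := ((((hasDerivAt_id (s : ℂ)).pow 2).neg).add
      ((hasDerivAt_id (s : ℂ)).const_mul (2 * Complex.I * q))).cexp
    convert! this using 1
    simp
  convert! ((P.hasDerivAt (s : ℂ)).mul h).comp_ofReal using 1
  simp
  ring

theorem gaussianFourierFunctional_shiftedHermite_mul (q : ℝ) (a : ℂ) (n : ℕ) (P : ℂ[X]) :
    gaussianFourierFunctional q (shiftedHermite a n * P) =
      gaussianFourierFunctional q
        ((((derivative : Module.End ℂ ℂ[X]) + (2 * (a + Complex.I * q)) • 1) ^ n) P) := by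
  induction n generalizing P with
  | zero => simp [shiftedHermite]
  | succ n ih =>
    rw [pow_succ, Module.End.mul_apply, ← ih]
    have h := gaussianFourierFunctional_derivative q (shiftedHermite a n * P)
    rw [← sub_eq_zero, ← map_sub] at h ⊢
    rw [← neg_eq_zero, ← map_neg, ← h]
    congr 1
    simp [shiftedHermite, smul_eq_C_mul]
    ring

theorem gaussianFourierFunctional_shiftedHermite (q : ℝ) (a : ℂ) (n : ℕ) :
    gaussianFourierFunctional q (shiftedHermite a n) =
      (2 * (a + Complex.I * q)) ^ n * gaussianFourierFunctional q 1 := by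
  induction n with
  | zero => simp [shiftedHermite]
  | succ n ih =>
    have h := gaussianFourierFunctional_derivative q (shiftedHermite a n)
    rw [pow_succ', mul_assoc, ← ih, ← smul_eq_mul, ← map_smul]
    rw [← sub_eq_zero, ← map_sub] at h ⊢
    rw [← neg_eq_zero, ← map_neg, ← h]
    congr 1
    simp [shiftedHermite, smul_eq_C_mul]
    ring

theorem gaussianFourierFunctional_shiftedHermite_mul_shiftedHermite (q : ℝ) (a b : ℂ) (m n : ℕ) :
    gaussianFourierFunctional q (shiftedHermite a m * shiftedHermite b n) =
      ∑ k ∈ Finset.range (m + 1), m.choose k * (2 ^ k * n.descFactorial k) *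
        (2 * (a + Complex.I * q)) ^ (m - k) * (2 * (b + Complex.I * q)) ^ (n - k) *
          gaussianFourierFunctional q 1 := by
  rw [gaussianFourierFunctional_shiftedHermite_mul,
    ((Commute.one_right _).smul_right _).add_pow, LinearMap.sum_apply, map_sum]
  refine Finset.sum_congr rfl fun k _ => ?_
  have h : ((derivative : Module.End ℂ ℂ[X]) ^ k *
      ((2 * (a + Complex.I * q)) • (1 : Module.End ℂ ℂ[X])) ^ (m - k) *
        (m.choose k : Module.End ℂ ℂ[X])) (shiftedHermite b n) =
      ((2 * (a + Complex.I * q)) ^ (m - k) * m.choose k * (2 ^ k * n.descFactorial k)) •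
        shiftedHermite b (n - k) := by
    have h' := iterate_derivative_shiftedHermite b n k
    rw [← Module.End.pow_apply] at h'
    rw [← nsmul_one, _root_.smul_pow, one_pow]
    simp only [Module.End.mul_apply, LinearMap.smul_apply, Module.End.one_apply, map_smul,
      map_nsmul, h']
    rw [smul_eq_C_mul, smul_eq_C_mul, nsmul_eq_mul]
    simp
    ring
  rw [h, map_smul, gaussianFourierFunctional_shiftedHermite, smul_eq_mul]
  ring

theorem sum_choose_mul_descFactorial_eq_laguerre (m : ℕ) (t : ℂ) :
    ∑ k ∈ Finset.range (m + 1), (m.choose k : ℂ) * (2 ^ k * m.descFactorial k) *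
        (-(2 * t)) ^ (m - k) =
      2 ^ m * m.factorial *
        ∑ k ∈ Finset.range (m + 1), ((m.choose k : ℂ) / k.factorial) * (-t) ^ k := by
  rw [← Finset.sum_range_reflect, Finset.mul_sum]
  refine Finset.sum_congr rfl fun k hk => ?_
  have hk' : k ≤ m := Nat.lt_succ_iff.mp (Finset.mem_range.mp hk)
  have h1 : m + 1 - 1 - k = m - k := by omega
  have h2 : m - (m - k) = k := by omega
  have h3 : (k.factorial : ℂ) * m.descFactorial (m - k) = m.factorial := by
    have := Nat.factorial_mul_descFactorial (Nat.sub_le m k)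
    rw [h2] at this
    exact_mod_cast this
  have h4 : (k.factorial : ℂ) ≠ 0 := by exact_mod_cast k.factorial_ne_zero
  have h5 : (2 : ℂ) ^ m = 2 ^ (m - k) * 2 ^ k := by rw [← pow_add, Nat.sub_add_cancel hk']
  rw [h1, h2, Nat.choose_symm hk', ← h3, h5, neg_mul_eq_mul_neg, mul_pow]
  field_simp

/-- The dimensionless form of the Wigner integral. -/
theorem integral_shiftedHermite_mul_shiftedHermite_neg (m : ℕ) (x q : ℝ) :
    ∫ s : ℝ, (((shiftedHermite x m).eval s : ℝ) : ℂ) * (((shiftedHermite (-x) m).eval s : ℝ) : ℂ) *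
        Complex.exp (-(s : ℂ) ^ 2 + 2 * Complex.I * q * s) =
      2 ^ m * m.factorial *
        (∑ k ∈ Finset.range (m + 1), ((m.choose k : ℂ) / k.factorial) *
          (-(2 * ((x : ℂ) ^ 2 + (q : ℂ) ^ 2))) ^ k) *
        ((Real.sqrt Real.pi : ℂ) * Complex.exp (-(q : ℂ) ^ 2)) := by
  have h := gaussianFourierFunctional_shiftedHermite_mul_shiftedHermite q x (-x) m m
  rw [← Finset.sum_mul, gaussianFourierFunctional_one] at h
  rw [← sum_choose_mul_descFactorial_eq_laguerre]
  have hev : ∀ a s : ℝ, (((shiftedHermite a m).eval s : ℝ) : ℂ) =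
      (shiftedHermite (a : ℂ) m).eval (s : ℂ) := fun a s => by
    have := map_shiftedHermite Complex.ofRealHom a m
    rw [Complex.ofRealHom_eq_coe] at this
    rw [← this]
    exact (eval_map_apply Complex.ofRealHom s).symm
  simp only [hev, ← eval_mul, Complex.ofReal_neg]
  refine h.trans ?_
  congr 1
  refine Finset.sum_congr rfl fun k _ => ?_
  rw [mul_assoc, ← mul_pow]
  congr 2
  linear_combination (4 * (q : ℂ) ^ 2) * Complex.I_sq

/-- The Wigner function of the m-th normalized harmonic-oscillator eigenfunction
φ_m of frequency μ is ((−1)^m/π) L_m(4H/μ) e^{−2H/μ}, where H(r,p) = p²/2 + μ²r²/2,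
H_m is the m-th physicists' Hermite polynomial (given by its Rodrigues formula) and
L_m is the m-th Laguerre polynomial. -/
theorem stmt_11 (μ : ℝ) (hμ : 0 < μ) (m : ℕ)
    (H : ℕ → ℝ → ℝ)
    (hH : ∀ (n : ℕ) (x : ℝ), H n x =
      (-1) ^ n * Real.exp (x ^ 2) * iteratedDeriv n (fun y : ℝ => Real.exp (-y ^ 2)) x)
    (L : ℕ → ℝ → ℝ)
    (hL : ∀ (n : ℕ) (t : ℝ), L n t =
      ∑ k ∈ Finset.range (n + 1), ((n.choose k : ℝ) / (Nat.factorial k : ℝ)) * (-t) ^ k)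
    (φ : ℝ → ℝ)
    (hφ : ∀ r : ℝ, φ r =
      (μ / Real.pi) ^ ((1 : ℝ) / 4) * (((2 : ℝ) ^ m * (Nat.factorial m : ℝ)) ^ (-(1 : ℝ) / 2)) *
        H m (Real.sqrt μ * r) * Real.exp (-μ * r ^ 2 / 2))
    (Ham : ℝ → ℝ → ℝ)
    (hHam : ∀ r p : ℝ, Ham r p = p ^ 2 / 2 + μ ^ 2 * r ^ 2 / 2) :
    ∀ r p : ℝ,
      (1 / (Real.pi : ℂ)) *
          ∫ z : ℝ, (φ (r - z) : ℂ) * (φ (r + z) : ℂ) *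
            Complex.exp (2 * Complex.I * (p : ℂ) * (z : ℂ)) =
      ((-1) ^ m / (Real.pi : ℂ)) * ((L m (4 * Ham r p / μ) : ℝ) : ℂ) *
        Complex.exp (((-2 * Ham r p / μ : ℝ) : ℂ)) := by
  intro r p
  have hw : 0 < Real.sqrt μ := Real.sqrt_pos.mpr hμ
  have hw2 : Real.sqrt μ ^ 2 = μ := Real.sq_sqrt hμ.le
  set w := Real.sqrt μ with hwdef
  have hHadd : ∀ x s : ℝ, H m (s + x) = (shiftedHermite x m).eval s := fun x s => by
    have h1 : ((-1 : ℝ) ^ m) * (-1) ^ m = 1 := by rw [← mul_pow]; simp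
    have h2 : Real.exp ((s + x) ^ 2) * Real.exp (-(s + x) ^ 2) = 1 := by
      rw [← Real.exp_add]; simp
    rw [hH, iteratedDeriv_gaussian]
    linear_combination (shiftedHermite x m).eval s *
      (Real.exp ((s + x) ^ 2) * Real.exp (-(s + x) ^ 2) * h1 + h2)
  have hHneg : ∀ x : ℝ, H m (-x) = (-1) ^ m * H m x := fun x => by
    have h := iteratedDeriv_comp_neg m (fun y : ℝ => Real.exp (-y ^ 2)) (-x)
    simp only [neg_sq, neg_neg, smul_eq_mul] at h
    rw [hH, hH, h, neg_sq]
    ring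
  obtain ⟨G, hG⟩ : ∃ G : ℝ → ℂ, ∀ s : ℝ, G s = (((shiftedHermite (w * r) m).eval s : ℝ) : ℂ) *
      (((shiftedHermite (-(w * r)) m).eval s : ℝ) : ℂ) *
      Complex.exp (-(s : ℂ) ^ 2 + 2 * Complex.I * ((p / w : ℝ) : ℂ) * s) := ⟨_, fun _ => rfl⟩
  have hpt : ∀ z : ℝ, (φ (r - z) : ℂ) * (φ (r + z) : ℂ) *
      Complex.exp (2 * Complex.I * (p : ℂ) * (z : ℂ)) =
      (((-1) ^ m * (w / Real.sqrt Real.pi) * ((2 : ℝ) ^ m * m.factorial)⁻¹ *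
        Real.exp (-(w * r) ^ 2) : ℝ) : ℂ) *
      G (w * z) := fun z => by
    have h1 : H m (w * (r - z)) = (-1) ^ m * (shiftedHermite (-(w * r)) m).eval (w * z) := by
      rw [← hHadd, ← hHneg]
      congr 1
      ring
    have h2 : H m (w * (r + z)) = (shiftedHermite (w * r) m).eval (w * z) := by
      rw [← hHadd]
      congr 1
      ring
    have h3 : (μ / Real.pi) ^ ((1 : ℝ) / 4) * (μ / Real.pi) ^ ((1 : ℝ) / 4) =
        w / Real.sqrt Real.pi := by
      rw [← Real.rpow_add (by positivity), hwdef, ← Real.sqrt_div hμ.le, Real.sqrt_eq_rpow]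
      norm_num
    have h4 : ((2 : ℝ) ^ m * (Nat.factorial m : ℝ)) ^ (-(1 : ℝ) / 2) *
        ((2 : ℝ) ^ m * (Nat.factorial m : ℝ)) ^ (-(1 : ℝ) / 2) =
        ((2 : ℝ) ^ m * m.factorial)⁻¹ := by
      rw [← Real.rpow_add (by positivity), ← Real.rpow_neg_one]
      norm_num
    have h5 : Real.exp (-μ * (r - z) ^ 2 / 2) * Real.exp (-μ * (r + z) ^ 2 / 2) =
        Real.exp (-(w * r) ^ 2) * Real.exp (-(w * z) ^ 2) := by
      rw [← Real.exp_add, ← Real.exp_add, ← hw2]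
      congr 1
      ring
    have h6 : Complex.exp (-((w * z : ℝ) : ℂ) ^ 2 +
        2 * Complex.I * ((p / w : ℝ) : ℂ) * (w * z : ℝ)) =
        (Real.exp (-(w * z) ^ 2) : ℂ) * Complex.exp (2 * Complex.I * (p : ℂ) * (z : ℂ)) := by
      have hw' : (w : ℂ) ≠ 0 := by exact_mod_cast hw.ne'
      rw [Complex.ofReal_exp, ← Complex.exp_add]
      congr 1
      push_cast
      field_simp
    have h7 : φ (r - z) * φ (r + z) =
        ((-1) ^ m * (w / Real.sqrt Real.pi) * ((2 : ℝ) ^ m * m.factorial)⁻¹ *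
          Real.exp (-(w * r) ^ 2)) * ((shiftedHermite (w * r) m).eval (w * z) *
          (shiftedHermite (-(w * r)) m).eval (w * z) * Real.exp (-(w * z) ^ 2)) := by
      rw [hφ, hφ, h1, h2, ← h3, ← h4]
      linear_combination (((μ / Real.pi) ^ ((1 : ℝ) / 4)) ^ 2 *
        (((2 : ℝ) ^ m * (Nat.factorial m : ℝ)) ^ (-(1 : ℝ) / 2)) ^ 2 * (-1) ^ m *
        (shiftedHermite (w * r) m).eval (w * z) *
        (shiftedHermite (-(w * r)) m).eval (w * z)) * h5
    rw [hG, h6, ← Complex.ofReal_mul, h7]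
    push_cast
    ring
  have hpi : (Real.sqrt Real.pi : ℂ) ≠ 0 := by
    exact_mod_cast (Real.sqrt_pos.mpr Real.pi_pos).ne'
  have hwC : (w : ℂ) ≠ 0 := by exact_mod_cast hw.ne'
  have hfac : (m.factorial : ℂ) ≠ 0 := by exact_mod_cast m.factorial_ne_zero
  have hexp : Complex.exp ((-2 * Ham r p / μ : ℝ) : ℂ) =
      Complex.exp (-((w : ℂ) * r) ^ 2) * Complex.exp (-((p / w : ℝ) : ℂ) ^ 2) := by
    rw [← Complex.exp_add, hHam, ← hw2]
    congr 1
    push_cast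
    field_simp
    ring
  have harg : 4 * Ham r p / μ = 2 * ((w * r) ^ 2 + (p / w) ^ 2) := by
    rw [hHam, ← hw2]
    field_simp
    ring
  rw [integral_congr_ae (.of_forall hpt), integral_const_mul, Measure.integral_comp_mul_left,
    funext hG, integral_shiftedHermite_mul_shiftedHermite_neg, abs_of_pos (inv_pos.mpr hw), hexp, harg, hL]
  simp only [Complex.real_smul]
  push_cast
  generalize (∑ k ∈ Finset.range (m + 1), _ : ℂ) = S
  field_simp
end

section
/- Fix μ > 0 and for m ∈ ℕ define Γ_m(v, p) := (1/π) ∫_ℝ L_m(4H(r,p)/μ) · exp(−2H(r,p)/μ) · exp(2ivr) dr, where H(r, p) := p²/2 + μ² r²/2 and L_m is the m-th Laguerre polynomial. Then for every x ∈ ℝ with |x| < 1 and all v, p ∈ ℝ, the series ∑_{m=0}^∞ Γ_m(v, p) x^m converges and equals (π μ (1 − x²))^{−1/2} · exp(−((1 + x)/(1 − x)) · p²/μ − ((1 − x)/(1 + x)) · v²/μ). -/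
open MeasureTheory

theorem norm_coeff_le_of_eventually_hasSum {f : ℂ → ℂ} {a : ℕ → ℂ} {R C : ℝ} (hR : 0 < R)
    (hf : DiffContOnCl ℂ f (Metric.ball 0 R))
    (ha : ∀ᶠ z in nhds (0 : ℂ), HasSum (fun n => a n * z ^ n) (f z))
    (hC : ∀ z ∈ Metric.sphere (0 : ℂ) R, ‖f z‖ ≤ C) (n : ℕ) : ‖a n‖ ≤ C / R ^ n := by
  have hfa : AnalyticAt ℂ f 0 :=
    hf.differentiableOn.analyticAt (Metric.ball_mem_nhds 0 hR)
  have hseries : HasFPowerSeriesAt f (FormalMultilinearSeries.ofScalars ℂ a) 0 := by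
    rw [hasFPowerSeriesAt_iff]
    filter_upwards [ha] with z hz
    simpa [FormalMultilinearSeries.coeff_ofScalars, mul_comm] using hz
  have hcoeff := congrArg (fun p => FormalMultilinearSeries.coeff p n)
    (hseries.eq_formalMultilinearSeries hfa.hasFPowerSeriesAt)
  simp only [FormalMultilinearSeries.coeff_ofScalars] at hcoeff
  have hbound := Complex.norm_iteratedDeriv_le_of_forall_mem_sphere_norm_le n hR hf hC
  rw [hcoeff, norm_div, Complex.norm_natCast, div_le_iff₀ (by positivity)]
  exact hbound.trans_eq (by ring)

theorem hasSum_choose_mul_pow {𝕜 : Type*} [NormedField 𝕜] [CompleteSpace 𝕜] (k : ℕ) {z : 𝕜}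
    (hz : ‖z‖ < 1) :
    HasSum (fun n : ℕ => (n.choose k : 𝕜) * z ^ n) (z ^ k / (1 - z) ^ (k + 1)) := by
  rw [← hasSum_nat_add_iff' k, Finset.sum_eq_zero, sub_zero]
  · convert! (hasSum_choose_mul_geometric_of_norm_lt_one k hz).mul_left (z ^ k) using 1
    · ext n; ring
    · ring
  · intro i hi
    simp [Nat.choose_eq_zero_of_lt (Finset.mem_range.1 hi)]

theorem hasSum_laguerre (t : ℂ) {z : ℂ} (hz : ‖z‖ < 1) :
    HasSum (fun n : ℕ => (∑ k ∈ Finset.range (n + 1),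
        ((n.choose k : ℂ) / (k.factorial : ℂ)) * (-t) ^ k) * z ^ n)
      ((1 - z)⁻¹ * Complex.exp (-t * z / (1 - z))) := by
  set g : ℕ × ℕ → ℂ := fun q =>
    (-t) ^ q.1 / (q.1.factorial : ℂ) * ((q.2.choose q.1 : ℂ) * z ^ q.2) with hg
  have hrow (k : ℕ) : HasSum (fun n => g (k, n))
      ((1 - z)⁻¹ * ((-t * z / (1 - z)) ^ k / (k.factorial : ℂ))) := by
    convert! (hasSum_choose_mul_pow k hz).mul_left ((-t) ^ k / (k.factorial : ℂ)) using 1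
    rw [div_pow, mul_pow, pow_succ]
    simp only [div_eq_mul_inv, mul_inv]
    ring
  have hrow_norm (k : ℕ) : HasSum (fun n => ‖g (k, n)‖)
      ((1 - ‖z‖)⁻¹ * ((‖t‖ * ‖z‖ / (1 - ‖z‖)) ^ k / (k.factorial : ℝ))) := by
    have hz' : ‖(‖z‖)‖ < 1 := by simpa using hz
    convert! (hasSum_choose_mul_pow k hz').mul_left (‖t‖ ^ k / (k.factorial : ℝ)) using 1
    · ext n
      simp [hg]
    · rw [div_pow, mul_pow, pow_succ]
      simp only [div_eq_mul_inv, mul_inv]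
      ring
  have hsum : Summable g := by
    refine Summable.of_norm ((summable_prod_of_nonneg fun q => norm_nonneg _).2
      ⟨fun k => (hrow_norm k).summable, ?_⟩)
    simp only [fun k => (hrow_norm k).tsum_eq]
    exact (Real.summable_pow_div_factorial _).mul_left _
  have hexp : HasSum (fun k : ℕ => (1 - z)⁻¹ * ((-t * z / (1 - z)) ^ k / (k.factorial : ℂ)))
      ((1 - z)⁻¹ * Complex.exp (-t * z / (1 - z))) := by
    rw [Complex.exp_eq_exp_ℂ]
    exact (NormedSpace.expSeries_div_hasSum_exp (-t * z / (1 - z))).mul_left _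
  have htotal : HasSum g ((1 - z)⁻¹ * Complex.exp (-t * z / (1 - z))) := by
    rw [← (hsum.hasSum.prod_fiberwise hrow).unique hexp]
    exact hsum.hasSum
  refine ((Equiv.prodComm ℕ ℕ).hasSum_iff.2 htotal).prod_fiberwise fun n => ?_
  have hcol : HasSum (fun k => g (k, n)) (∑ k ∈ Finset.range (n + 1), g (k, n)) :=
    hasSum_sum_of_ne_finset_zero fun k hk => by
      simp [hg, Nat.choose_eq_zero_of_lt (by simpa using hk : n < k)]
  convert! hcol using 1
  rw [Finset.sum_mul]
  exact Finset.sum_congr rfl fun k _ => by simp only [hg]; ring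

theorem div_one_add_le_re_cayley {z : ℂ} {ρ : ℝ} (hz : ‖z‖ = ρ) (hρ : ρ < 1) :
    (1 - ρ) / (1 + ρ) ≤ ((1 + z) / (1 - z)).re := by
  have hρ0 : 0 ≤ ρ := hz ▸ norm_nonneg z
  have hsq : z.re ^ 2 + z.im ^ 2 = ρ ^ 2 := by
    rw [← hz, Complex.sq_norm, Complex.normSq_apply]; ring
  have hre : |z.re| ≤ ρ := hz ▸ Complex.abs_re_le_norm z
  have hN : Complex.normSq (1 - z) = 1 - 2 * z.re + ρ ^ 2 := by
    rw [Complex.normSq_apply, ← hsq]; simp; ring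
  have h1 := (abs_le.1 hre)
  have hpos : 0 < 1 - 2 * z.re + ρ ^ 2 := by nlinarith [sq_nonneg (1 - ρ)]
  have hval : ((1 + z) / (1 - z)).re = (1 - ρ ^ 2) / (1 - 2 * z.re + ρ ^ 2) := by
    rw [Complex.div_re, hN, ← add_div, ← hsq]; simp; ring
  rw [hval, div_le_div_iff₀ (by linarith) hpos]
  nlinarith [mul_nonneg (sub_nonneg.2 hρ.le) (by linarith : 0 ≤ ρ + z.re)]

theorem norm_laguerre_mul_exp_le {t : ℝ} (ht : 0 ≤ t) {ρ : ℝ} (hρ0 : 0 < ρ) (hρ : ρ < 1) (n : ℕ) :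
    ‖(∑ k ∈ Finset.range (n + 1), ((n.choose k : ℂ) / (k.factorial : ℂ)) * (-(t : ℂ)) ^ k) *
        Complex.exp (-(t / 2 : ℝ))‖ ≤
      (1 - ρ)⁻¹ * Real.exp (-((1 - ρ) / (1 + ρ) * (t / 2))) / ρ ^ n := by
  have hne {z : ℂ} (hz : ‖z‖ < 1) : 1 - z ≠ 0 := fun h => by
    simp [← sub_eq_zero.1 h] at hz
  have key (z : ℂ) (hz : ‖z‖ < 1) :
      (1 - z)⁻¹ * Complex.exp (-(t : ℂ) * z / (1 - z)) * Complex.exp (-(t / 2 : ℝ)) =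
      (1 - z)⁻¹ * Complex.exp (-((t / 2 : ℝ) * ((1 + z) / (1 - z)))) := by
    rw [mul_assoc, ← Complex.exp_add]
    congr 2
    have := hne hz
    push_cast
    field
  refine norm_coeff_le_of_eventually_hasSum
    (a := fun n => (∑ k ∈ Finset.range (n + 1), ((n.choose k : ℂ) / (k.factorial : ℂ)) *
      (-(t : ℂ)) ^ k) * Complex.exp (-(t / 2 : ℝ)))
    (f := fun z => (1 - z)⁻¹ * Complex.exp (-((t / 2 : ℝ) * ((1 + z) / (1 - z)))))
    hρ0 ?_ ?_ ?_ n
  · refine DifferentiableOn.diffContOnCl (𝕜 := ℂ) fun z hz => ?_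
    have hz' := hne ((mem_closedBall_zero_iff.1
      (Metric.closure_ball_subset_closedBall hz)).trans_lt hρ)
    exact DifferentiableAt.differentiableWithinAt (by fun_prop (disch := assumption))
  · filter_upwards [Metric.ball_mem_nhds (0 : ℂ) one_pos] with z hz
    have hz' : ‖z‖ < 1 := mem_ball_zero_iff.1 hz
    rw [← key z hz']
    convert! (hasSum_laguerre t hz').mul_right (Complex.exp (-(t / 2 : ℝ))) using 1
    ext m
    ring
  · intro z hz
    have hz' : ‖z‖ = ρ := mem_sphere_zero_iff_norm.1 hz
    rw [norm_mul, norm_inv, Complex.norm_exp]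
    have h1 : 1 - ρ ≤ ‖1 - z‖ := by
      simpa [hz'] using norm_sub_norm_le (1 : ℂ) z
    have h2 := div_one_add_le_re_cayley hz' hρ
    rw [Complex.neg_re, Complex.re_ofReal_mul, mul_comm (t / 2)]
    gcongr

theorem inv_pi_mul_sqrt_div_eq {μ x : ℝ} (hμ : 0 < μ) (hx : |x| < 1) :
    1 / Real.pi * ((1 - x)⁻¹ * (Real.pi / (μ * ((1 + x) / (1 - x)))) ^ (1 / 2 : ℝ)) =
      (Real.pi * μ * (1 - x ^ 2)) ^ (-(1 : ℝ) / 2) := by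
  obtain ⟨h1, h2⟩ := abs_lt.1 hx
  have hp : 0 < 1 + x := by linarith
  have hm : 0 < 1 - x := by linarith
  have hsq : 0 < 1 - x ^ 2 := by nlinarith
  have hπ := Real.pi_pos
  have hquot : Real.pi / (μ * ((1 + x) / (1 - x))) =
      (Real.pi * (1 - x)) ^ 2 / (Real.pi * μ * (1 - x ^ 2)) := by
    rw [show 1 - x ^ 2 = (1 + x) * (1 - x) by ring]
    field
  rw [neg_div, Real.rpow_neg (by positivity), ← Real.sqrt_eq_rpow, ← Real.sqrt_eq_rpow, hquot,
    Real.sqrt_div (by positivity), Real.sqrt_sq (by positivity)]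
  field

/-- Generating-function identity for the partially Fourier-transformed oscillator
Wigner functions: with Γ_m(v, p) := (1/π) ∫ L_m(4H(r,p)/μ) e^{−2H(r,p)/μ} e^{2ivr} dr,
for |x| < 1 the series ∑ Γ_m(v, p) x^m converges to
(πμ(1 − x²))^{−1/2} exp(−((1+x)/(1−x)) p²/μ − ((1−x)/(1+x)) v²/μ). -/
theorem stmt_12 (μ : ℝ) (hμ : 0 < μ)
    (L : ℕ → ℝ → ℝ)
    (hL : ∀ (n : ℕ) (t : ℝ), L n t =
      ∑ k ∈ Finset.range (n + 1), ((n.choose k : ℝ) / (Nat.factorial k : ℝ)) * (-t) ^ k)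
    (Ham : ℝ → ℝ → ℝ)
    (hHam : ∀ r p : ℝ, Ham r p = p ^ 2 / 2 + μ ^ 2 * r ^ 2 / 2)
    (Γ : ℕ → ℝ → ℝ → ℂ)
    (hΓ : ∀ (m : ℕ) (v p : ℝ), Γ m v p =
      (1 / (Real.pi : ℂ)) *
        ∫ r : ℝ, ((L m (4 * Ham r p / μ) : ℝ) : ℂ) *
          Complex.exp (((-2 * Ham r p / μ : ℝ) : ℂ)) *
          Complex.exp (2 * Complex.I * (v : ℂ) * (r : ℂ))) :
    ∀ x : ℝ, |x| < 1 → ∀ v p : ℝ,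
      HasSum (fun m : ℕ => Γ m v p * (x : ℂ) ^ m)
        ((((Real.pi * μ * (1 - x ^ 2)) ^ (-(1 : ℝ) / 2) : ℝ) : ℂ) *
          Complex.exp ((((-((1 + x) / (1 - x)) * p ^ 2 / μ)
            - ((1 - x) / (1 + x)) * v ^ 2 / μ : ℝ) : ℂ))) := by
  intro x hx v p
  obtain ⟨ρ, hxρ, hρ⟩ := exists_between hx
  have hρ0 : 0 < ρ := (abs_nonneg x).trans_lt hxρ
  obtain ⟨hx1, hx2⟩ := abs_lt.1 hx
  have hxm : 0 < 1 - x := by linarith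
  have hxp : 0 < 1 + x := by linarith
  have ht (r : ℝ) : 0 ≤ 4 * Ham r p / μ := by rw [hHam]; positivity
  have hLC (m : ℕ) (t : ℝ) : ((L m t : ℝ) : ℂ) =
      ∑ k ∈ Finset.range (m + 1), ((m.choose k : ℂ) / (k.factorial : ℂ)) * (-(t : ℂ)) ^ k := by
    rw [hL]; push_cast; rfl
  have hexp (r : ℝ) : Complex.exp (((-2 * Ham r p / μ : ℝ) : ℂ)) =
      Complex.exp (-((4 * Ham r p / μ / 2 : ℝ) : ℂ)) := by
    rw [← Complex.ofReal_neg]; congr 2; ring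
  set c : ℝ := (1 - ρ) / (1 + ρ) with hc
  have hc0 : 0 < c := div_pos (by linarith) (by linarith)
  set w : ℝ := (1 + x) / (1 - x) with hw
  have hw0 : 0 < w := div_pos hxp hxm
  have hsum := hasSum_integral_of_dominated_convergence (μ := volume)
    (F := fun (m : ℕ) (r : ℝ) => ((L m (4 * Ham r p / μ) : ℝ) : ℂ) *
      Complex.exp (((-2 * Ham r p / μ : ℝ) : ℂ)) *
      Complex.exp (2 * Complex.I * (v : ℂ) * (r : ℂ)) * (x : ℂ) ^ m)
    (f := fun r : ℝ => (1 - (x : ℂ))⁻¹ * Complex.exp (((-(μ * w) : ℝ) : ℂ) * (r : ℂ) ^ 2 +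
      2 * Complex.I * v * r + ((-(w * p ^ 2 / μ) : ℝ) : ℂ)))
    (fun m r => (|x| / ρ) ^ m * ((1 - ρ)⁻¹ * Real.exp (-(c * μ) * r ^ 2)))
    ?_ ?_ ?_ ?_ ?_
  · simp only [integral_mul_const, integral_const_mul] at hsum
    rw [integral_cexp_quadratic (by rw [Complex.ofReal_re]; exact neg_neg_of_pos (by positivity))]
      at hsum
    convert! hsum.mul_left (1 / (Real.pi : ℂ)) using 1
    · ext m
      rw [hΓ]; ring
    · rw [← inv_pi_mul_sqrt_div_eq hμ hx, ← hw]
      have hcpow : ((Real.pi : ℂ) / -((-(μ * w) : ℝ) : ℂ)) ^ (1 / 2 : ℂ) =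
          (((Real.pi / (μ * w)) ^ (1 / 2 : ℝ) : ℝ) : ℂ) := by
        rw [Complex.ofReal_cpow (by positivity)]
        push_cast
        rw [neg_neg]
      have harg : ((-w * p ^ 2 / μ - (1 - x) / (1 + x) * v ^ 2 / μ : ℝ) : ℂ) =
          ((-(w * p ^ 2 / μ) : ℝ) : ℂ) -
            (2 * Complex.I * v) ^ 2 / (4 * ((-(μ * w) : ℝ) : ℂ)) := by
        have hinv : (1 - x) / (1 + x) = w⁻¹ := by rw [hw, inv_div]
        rw [hinv, mul_pow, mul_pow, Complex.I_sq]
        have : (w : ℂ) ≠ 0 := by exact_mod_cast hw0.ne'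
        have : (μ : ℂ) ≠ 0 := by exact_mod_cast hμ.ne'
        push_cast
        field
      rw [hcpow, harg]
      push_cast
      ring
  · intro m
    refine Continuous.aestronglyMeasurable ?_
    simp only [hLC, hHam]
    fun_prop
  · refine fun m => Filter.Eventually.of_forall fun r => ?_
    have hb := norm_laguerre_mul_exp_le (ht r) hρ0 hρ m
    rw [← hLC, ← hexp] at hb
    have hphase : ‖Complex.exp (2 * Complex.I * (v : ℂ) * (r : ℂ))‖ = 1 := by
      rw [Complex.norm_exp]; simp
    have hmono : Real.exp (-(c * (4 * Ham r p / μ / 2))) ≤ Real.exp (-(c * μ) * r ^ 2) := by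
      have : 4 * Ham r p / μ / 2 = p ^ 2 / μ + μ * r ^ 2 := by rw [hHam]; field
      rw [this, Real.exp_le_exp]
      have : 0 ≤ c * (p ^ 2 / μ) := by positivity
      linarith
    have hρ' : 0 ≤ (1 - ρ)⁻¹ := inv_nonneg.2 (by linarith)
    rw [norm_mul, norm_mul _ (Complex.exp (2 * _ * _ * _)), hphase, mul_one, norm_pow,
      Complex.norm_real, Real.norm_eq_abs]
    calc _ ≤ (1 - ρ)⁻¹ * Real.exp (-(c * (4 * Ham r p / μ / 2))) / ρ ^ m * |x| ^ m := by gcongr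
      _ ≤ (1 - ρ)⁻¹ * Real.exp (-(c * μ) * r ^ 2) / ρ ^ m * |x| ^ m := by gcongr
      _ = _ := by rw [div_pow]; ring
  · exact Filter.Eventually.of_forall fun r => (summable_geometric_of_lt_one (by positivity)
      ((div_lt_one hρ0).2 hxρ)).mul_right _
  · simp only [tsum_mul_right]
    exact ((integrable_exp_neg_mul_sq (by positivity)).const_mul _).const_mul _
  · refine Filter.Eventually.of_forall fun r => ?_
    have hxC : ‖(x : ℂ)‖ < 1 := by simpa using hx
    convert! (hasSum_laguerre ((4 * Ham r p / μ : ℝ) : ℂ) hxC).mul_right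
      (Complex.exp (((-2 * Ham r p / μ : ℝ) : ℂ)) *
        Complex.exp (2 * Complex.I * (v : ℂ) * (r : ℂ))) using 1
    · ext m
      rw [hLC]; ring
    · rw [← Complex.exp_add, mul_assoc (1 - (x : ℂ))⁻¹, ← Complex.exp_add, hHam, hw]
      congr 2
      have : (μ : ℂ) ≠ 0 := by exact_mod_cast hμ.ne'
      have : (1 : ℂ) - x ≠ 0 := by exact_mod_cast hxm.ne'
      push_cast
      field
end

section
/- Fix μ > 0 and for m ∈ ℕ define Γ_m(v, p) := (1/π) ∫_ℝ L_m(4H(r,p)/μ) · exp(−2H(r,p)/μ) · exp(2ivr) dr, where H(r, p) := p²/2 + μ² r²/2 and L_m is the m-th Laguerre polynomial. Then for all m ∈ ℕ and all v, p ∈ ℝ: Γ_m(v, p) = (−1)^m · Γ_m(p, v). In particular Γ_m is symmetric under the exchange of v and p when m is even and antisymmetric when m is odd. -/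
open MeasureTheory

/-- The Laguerre polynomial `L_n` as a real function. -/
noncomputable def laguerreEval (n : ℕ) (t : ℝ) : ℝ :=
  ∑ k ∈ Finset.range (n + 1), ((n.choose k : ℝ) / (Nat.factorial k : ℝ)) * (-t) ^ k

lemma continuous_laguerreEval (n : ℕ) : Continuous (laguerreEval n) := by
  unfold laguerreEval
  fun_prop

lemma abs_laguerreEval_le (n : ℕ) (t : ℝ) : |laguerreEval n t| ≤ laguerreEval n (-|t|) := by
  unfold laguerreEval
  refine (Finset.abs_sum_le_sum_abs _ _).trans (Finset.sum_le_sum fun k _ => ?_)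
  rw [abs_mul, abs_pow, abs_neg, neg_neg, abs_of_nonneg (by positivity)]

lemma hasSum_laguerre_double_row {z : ℝ} (hz : |z| < 1) (t : ℝ) (k : ℕ) :
    HasSum (fun j : ℕ => ((j + k).choose k : ℝ) / k.factorial * (-t) ^ k * z ^ (j + k))
      ((1 - z)⁻¹ * ((-(z * t / (1 - z))) ^ k / k.factorial)) := by
  have hz1 : 1 - z ≠ 0 := by linarith [(abs_lt.mp hz).2]
  convert! (hasSum_choose_mul_geometric_of_norm_lt_one k (r := z) hz).mul_left
    ((-t) ^ k * z ^ k / k.factorial) using 1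
  · ext j
    ring
  · have : -(z * t / (1 - z)) = (-t) * z * (1 - z)⁻¹ := by ring
    rw [this, mul_pow, mul_pow, inv_pow, pow_succ]
    field_simp

lemma summable_laguerre_double {z : ℝ} (hz : |z| < 1) (t : ℝ) :
    Summable fun x : ℕ × ℕ =>
      ((x.2 + x.1).choose x.1 : ℝ) / x.1.factorial * (-t) ^ x.1 * z ^ (x.2 + x.1) := by
  have hrow := hasSum_laguerre_double_row (z := |z|) (by simpa using hz) (-|t|)
  have hmajor : Summable fun x : ℕ × ℕ =>
      ((x.2 + x.1).choose x.1 : ℝ) / x.1.factorial * (-(-|t|)) ^ x.1 * |z| ^ (x.2 + x.1) := by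
    refine (summable_prod_of_nonneg ?_).mpr ⟨fun k => (hrow k).summable, ?_⟩
    · intro x
      simp only [neg_neg, Pi.zero_apply]
      positivity
    · refine Summable.congr ?_ fun k => (hrow k).tsum_eq.symm
      exact (NormedSpace.expSeries_div_hasSum_exp
        (-(|z| * -|t| / (1 - |z|)))).summable.mul_left (1 - |z|)⁻¹
  refine hmajor.of_norm_bounded fun x => le_of_eq ?_
  rw [norm_mul, norm_mul, norm_pow, norm_pow, norm_neg, neg_neg, Real.norm_eq_abs,
    Real.norm_eq_abs, Real.norm_eq_abs, abs_of_nonneg (by positivity)]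

/-- The generating function of the Laguerre polynomials. -/
lemma hasSum_pow_mul_laguerreEval {z : ℝ} (hz : |z| < 1) (t : ℝ) :
    HasSum (fun n : ℕ => z ^ n * laguerreEval n t)
      ((1 - z)⁻¹ * Real.exp (-(z * t / (1 - z)))) := by
  have hsum := summable_laguerre_double hz t
  have hrows := hsum.hasSum.prod_fiberwise (hasSum_laguerre_double_row hz t)
  have hexp := (NormedSpace.expSeries_div_hasSum_exp (-(z * t / (1 - z)))).mul_left (1 - z)⁻¹
  rw [← Real.exp_eq_exp_ℝ] at hexp
  have htotal := hsum.hasSum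
  rw [hrows.unique hexp, ← Finset.HasAntidiagonal.sigmaAntidiagonalEquivProd.hasSum_iff] at htotal
  convert! htotal.sigma fun n => hasSum_fintype _ using 1
  ext n
  rw [Finset.univ_eq_attach]
  simp only [Function.comp_apply, Finset.HasAntidiagonal.sigmaAntidiagonalEquivProd_apply]
  rw [Finset.sum_attach (Finset.HasAntidiagonal.antidiagonal n) fun x : ℕ × ℕ =>
      ((x.2 + x.1).choose x.1 : ℝ) / x.1.factorial * (-t) ^ x.1 * z ^ (x.2 + x.1),
    Finset.Nat.sum_antidiagonal_eq_sum_range_succ_mk, laguerreEval, Finset.mul_sum]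
  refine Finset.sum_congr rfl fun k hk => ?_
  have hkn : n - k + k = n := by
    have := Finset.mem_range.mp hk
    omega
  simp only [hkn]
  ring

/-- The energy variable `4 H(r, p) / μ` of the oscillator. -/
noncomputable def oscillatorArg (μ p r : ℝ) : ℝ := 2 * p ^ 2 / μ + 2 * μ * r ^ 2

lemma oscillatorArg_nonneg {μ : ℝ} (hμ : 0 < μ) (p r : ℝ) : 0 ≤ oscillatorArg μ p r := by
  unfold oscillatorArg
  positivity

/-- `π Γ_m(v, p)`. -/
noncomputable def wignerFourier (μ : ℝ) (m : ℕ) (v p : ℝ) : ℂ :=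
  ∫ r : ℝ, ((laguerreEval m (oscillatorArg μ p r) : ℝ) : ℂ) *
    Complex.exp ((-(oscillatorArg μ p r / 2) : ℝ) : ℂ) *
    Complex.exp (2 * Complex.I * (v : ℂ) * (r : ℂ))

lemma integrable_exp_neg_mul_oscillatorArg {μ a : ℝ} (hμ : 0 < μ) (ha : 0 < a) (p : ℝ) :
    Integrable fun r : ℝ => Real.exp (-(a * oscillatorArg μ p r)) := by
  convert! (integrable_exp_neg_mul_sq (b := a * (2 * μ)) (by positivity)).const_mul
    (Real.exp (-(a * (2 * p ^ 2 / μ)))) using 1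
  ext r
  rw [← Real.exp_add, oscillatorArg]
  ring_nf

lemma norm_exp_two_I_mul (v r : ℝ) :
    ‖Complex.exp (2 * Complex.I * (v : ℂ) * (r : ℂ))‖ = 1 := by
  rw [show 2 * Complex.I * (v : ℂ) * (r : ℂ) = ((2 * v * r : ℝ) : ℂ) * Complex.I by
    push_cast; ring]
  exact Complex.norm_exp_ofReal_mul_I _

lemma hasSum_wignerFourier_integral {μ z : ℝ} (hμ : 0 < μ) (hz : |z| < 1 / 3) (v p : ℝ) :
    HasSum (fun m : ℕ => z ^ m • wignerFourier μ m v p)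
      (∫ r : ℝ, (((1 - z)⁻¹ * Real.exp (-(z * oscillatorArg μ p r / (1 - z))) : ℝ) : ℂ) *
        Complex.exp ((-(oscillatorArg μ p r / 2) : ℝ) : ℂ) *
        Complex.exp (2 * Complex.I * (v : ℂ) * (r : ℂ))) := by
  have hz1 : |z| < 1 := by linarith
  have hbound : ∀ r : ℝ,
      HasSum (fun m : ℕ => |z| ^ m * laguerreEval m (-oscillatorArg μ p r) *
          Real.exp (-(oscillatorArg μ p r / 2)))
        ((1 - |z|)⁻¹ * Real.exp (-((1 / 2 - |z| / (1 - |z|)) * oscillatorArg μ p r))) := by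
    intro r
    convert! (hasSum_pow_mul_laguerreEval (z := |z|) (by simpa using hz1)
      (-oscillatorArg μ p r)).mul_right (Real.exp (-(oscillatorArg μ p r / 2))) using 1
    rw [mul_assoc, ← Real.exp_add]
    ring_nf
  have hrate : 0 < 1 / 2 - |z| / (1 - |z|) := by
    rw [sub_pos, div_lt_div_iff₀ (by linarith) (by norm_num)]
    linarith
  simp only [wignerFourier, ← integral_smul]
  refine hasSum_integral_of_dominated_convergence
    (fun m r => |z| ^ m * laguerreEval m (-oscillatorArg μ p r) *
      Real.exp (-(oscillatorArg μ p r / 2))) (fun m => ?_) (fun m => ?_) ?_ ?_ ?_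
  · have := continuous_laguerreEval m
    unfold oscillatorArg
    exact Continuous.aestronglyMeasurable (by fun_prop)
  · refine .of_forall fun r => ?_
    rw [norm_smul, norm_mul, norm_mul, norm_exp_two_I_mul, mul_one, ← Complex.ofReal_exp,
      Complex.norm_real, Complex.norm_real, norm_pow, Real.norm_eq_abs, Real.norm_eq_abs,
      Real.norm_eq_abs, Real.abs_exp, ← mul_assoc]
    gcongr
    simpa [abs_of_nonneg (oscillatorArg_nonneg hμ p r)] using
      abs_laguerreEval_le m (oscillatorArg μ p r)
  · exact .of_forall fun r => (hbound r).summable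
  · simp_rw [(hbound _).tsum_eq]
    exact (integrable_exp_neg_mul_oscillatorArg hμ hrate p).const_mul _
  · refine .of_forall fun r => ?_
    convert! ((Complex.hasSum_ofReal.mpr (hasSum_pow_mul_laguerreEval hz1
      (oscillatorArg μ p r))).mul_right
        (Complex.exp ((-(oscillatorArg μ p r / 2) : ℝ) : ℂ))).mul_right
        (Complex.exp (2 * Complex.I * (v : ℂ) * (r : ℂ))) using 1
    ext m
    simp only [Complex.real_smul]
    push_cast
    ring

/-- The generating function of `wignerFourier μ · v p` with `c = (1 + z) / (1 - z)`. -/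
lemma hasSum_wignerFourier {μ z : ℝ} (hμ : 0 < μ) (hz : |z| < 1 / 3) (v p : ℝ) :
    HasSum (fun m : ℕ => z ^ m • wignerFourier μ m v p)
      (((√(Real.pi / μ) / √((1 - z) * (1 + z)) *
        Real.exp (-((1 + z) / (1 - z) * p ^ 2 / μ) - (1 - z) / (1 + z) * v ^ 2 / μ) : ℝ)) : ℂ) := by
  obtain ⟨hzl, hzr⟩ := abs_lt.mp hz
  have h1 : 0 < 1 - z := by linarith
  have h2 : 0 < 1 + z := by linarith
  set c : ℝ := (1 + z) / (1 - z) with hc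
  have hc0 : 0 < c := by positivity
  convert! hasSum_wignerFourier_integral hμ hz v p using 1
  have hint : ∀ r : ℝ,
      (((1 - z)⁻¹ * Real.exp (-(z * oscillatorArg μ p r / (1 - z))) : ℝ) : ℂ) *
        Complex.exp ((-(oscillatorArg μ p r / 2) : ℝ) : ℂ) *
        Complex.exp (2 * Complex.I * (v : ℂ) * (r : ℂ)) =
      (((1 - z)⁻¹ * Real.exp (-(c * p ^ 2 / μ)) : ℝ) : ℂ) *
        (Complex.exp (Complex.I * ((2 * v : ℝ) : ℂ) * r) *
          Complex.exp (-((c * μ : ℝ) : ℂ) * (r : ℂ) ^ 2)) := by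
    intro r
    have hexp : Real.exp (-(z * oscillatorArg μ p r / (1 - z))) *
        Real.exp (-(oscillatorArg μ p r / 2)) =
        Real.exp (-(c * p ^ 2 / μ)) * Real.exp (-(c * μ) * r ^ 2) := by
      rw [← Real.exp_add, ← Real.exp_add, oscillatorArg, hc]
      congr 1
      field_simp
      ring
    have hexp' := congrArg (fun x : ℝ => (x : ℂ)) hexp
    push_cast at hexp' ⊢
    rw [mul_assoc ((1 - z : ℂ)⁻¹), hexp']
    ring_nf
  simp_rw [hint]
  rw [integral_const_mul, fourierIntegral_gaussian (by simpa using by positivity)]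
  have hsqrt : ((Real.pi : ℂ) / ((c * μ : ℝ) : ℂ)) ^ (1 / 2 : ℂ) =
      ((√(Real.pi / (c * μ)) : ℝ) : ℂ) := by
    rw [Real.sqrt_eq_rpow, Complex.ofReal_cpow (by positivity)]
    push_cast
    rfl
  rw [hsqrt]
  have hroot : √(Real.pi / μ) / √((1 - z) * (1 + z)) = (1 - z)⁻¹ * √(Real.pi / (c * μ)) := by
    rw [← Real.sqrt_div (by positivity), ← Real.sqrt_sq (inv_pos.mpr h1).le,
      ← Real.sqrt_mul (by positivity), hc]
    congr 1
    field_simp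
  have hgauss : Complex.exp (-((2 * v : ℝ) : ℂ) ^ 2 / (4 * ((c * μ : ℝ) : ℂ))) =
      ((Real.exp (-((1 - z) / (1 + z) * v ^ 2 / μ)) : ℝ) : ℂ) := by
    rw [Complex.ofReal_exp]
    congr 1
    norm_cast
    rw [hc]
    field_simp
    ring
  rw [hgauss, hroot, sub_eq_add_neg (-(c * p ^ 2 / μ)), Real.exp_add]
  push_cast
  ring

lemma eq_of_eventually_hasSum_pow_smul {a b : ℕ → ℂ} {f : ℝ → ℂ}
    (ha : ∀ᶠ z in nhds (0 : ℝ), HasSum (fun n => z ^ n • a n) (f z))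
    (hb : ∀ᶠ z in nhds (0 : ℝ), HasSum (fun n => z ^ n • b n) (f z)) : a = b := by
  have key : ∀ c : ℕ → ℂ, (∀ᶠ z in nhds (0 : ℝ), HasSum (fun n => z ^ n • c n) (f z)) →
      HasFPowerSeriesAt f
        ((fun n => ContinuousMultilinearMap.mkPiRing ℝ (Fin n) (c n) :
          FormalMultilinearSeries ℝ ℝ ℂ)) (0 : ℝ) := by
    intro c hc
    refine hasFPowerSeriesAt_iff.mpr ?_
    simpa [FormalMultilinearSeries.coeff] using hc
  funext n
  have h := congrFun ((key a ha).eq_formalMultilinearSeries (key b hb)) n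
  exact ContinuousMultilinearMap.mkPiRing_eq_iff.mp h

lemma wignerFourier_swap {μ : ℝ} (hμ : 0 < μ) (m : ℕ) (v p : ℝ) :
    wignerFourier μ m v p = (-1) ^ m * wignerFourier μ m p v := by
  have hnear : ∀ᶠ z in nhds (0 : ℝ), |z| < 1 / 3 := by
    simpa using eventually_abs_sub_lt (0 : ℝ) (by norm_num : (0 : ℝ) < 1 / 3)
  refine congrFun (eq_of_eventually_hasSum_pow_smul
    (b := fun m => (-1) ^ m * wignerFourier μ m p v)
    (hnear.mono fun z hz => hasSum_wignerFourier hμ hz v p)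
    (hnear.mono fun z hz => ?_)) m
  convert! hasSum_wignerFourier (z := -z) hμ (by simpa using hz) p v using 1
  · ext n
    rw [neg_pow z n]
    simp only [Complex.real_smul]
    push_cast
    ring
  · rw [sub_neg_eq_add, ← sub_eq_add_neg, mul_comm (1 + z)]
    congr 3
    ring

/-- Exchange symmetry of the partially Fourier-transformed oscillator Wigner
functions: with Γ_m(v, p) := (1/π) ∫ L_m(4H(r,p)/μ) e^{−2H(r,p)/μ} e^{2ivr} dr,
one has Γ_m(v, p) = (−1)^m Γ_m(p, v), i.e. Γ_m is symmetric in (v, p) for even m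
and antisymmetric for odd m. -/
theorem stmt_13 (μ : ℝ) (hμ : 0 < μ)
    (L : ℕ → ℝ → ℝ)
    (hL : ∀ (n : ℕ) (t : ℝ), L n t =
      ∑ k ∈ Finset.range (n + 1), ((n.choose k : ℝ) / (Nat.factorial k : ℝ)) * (-t) ^ k)
    (Ham : ℝ → ℝ → ℝ)
    (hHam : ∀ r p : ℝ, Ham r p = p ^ 2 / 2 + μ ^ 2 * r ^ 2 / 2)
    (Γ : ℕ → ℝ → ℝ → ℂ)
    (hΓ : ∀ (m : ℕ) (v p : ℝ), Γ m v p =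
      (1 / (Real.pi : ℂ)) *
        ∫ r : ℝ, ((L m (4 * Ham r p / μ) : ℝ) : ℂ) *
          Complex.exp (((-2 * Ham r p / μ : ℝ) : ℂ)) *
          Complex.exp (2 * Complex.I * (v : ℂ) * (r : ℂ))) :
    ∀ (m : ℕ) (v p : ℝ), Γ m v p = (-1) ^ m * Γ m p v := by
  intro m v p
  have hΓ' : ∀ v p : ℝ, Γ m v p = (1 / (Real.pi : ℂ)) * wignerFourier μ m v p := by
    intro v p
    rw [hΓ, wignerFourier]
    congr 2
    ext r
    have harg : 4 * Ham r p / μ = oscillatorArg μ p r := by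
      rw [hHam, oscillatorArg]
      field_simp
      ring
    have hweight : -2 * Ham r p / μ = -(oscillatorArg μ p r / 2) := by
      rw [← harg]
      ring
    rw [harg, hweight, hL, laguerreEval]
  rw [hΓ', hΓ', wignerFourier_swap hμ]
  ring
end
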